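/- arXiv:1912.07993 — 2 statements merged into one kernel-verified Lean document; each statement's English description precedes it below -/
import Mathlib

section
/- There exists an absolute constant C > 0 such that for every dimension n ≥ 1 and all convex bodies K, L ⊆ ℝⁿ there exists a volume-preserving linear map T ∈ SL(n) with W(K + TL)^{1/n} ≤ C · (W(K)^{1/n} + W(L)^{1/n}), where K + TL denotes the Minkowski sum. -/
open scoped Pointwise
open MeasureTheory Metric Real

/-- The Wills functional `W(K) = ∫_{ℝⁿ} e^{-π d(x,K)²} dx`. -/
noncomputable def wills {n : ℕ} (K : Set (EuclideanSpace ℝ (Fin n))) : ℝ :=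
  ∫ x, Real.exp (-π * (Metric.infDist x K) ^ 2)


namespace RBM

/-- Integrals of locally dominated families of entire functions are entire. -/
theorem entire_integral {α : Type*} [MeasurableSpace α] {μ : Measure α} (F : ℂ → α → ℂ)
    (hd : ∀ x, Differentiable ℂ (fun z => F z x))
    (hm : ∀ z, AEStronglyMeasurable (F z) μ)
    (hb : ∀ r : ℝ, 0 < r → ∃ g : α → ℝ, Integrable g μ ∧ ∀ z : ℂ, ‖z‖ ≤ r → ∀ x, ‖F z x‖ ≤ g x) :
    Differentiable ℂ (fun z => ∫ x, F z x ∂μ) := by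
  intro z₀
  obtain ⟨g, hg, hgb⟩ := hb (‖z₀‖ + 2) (by positivity)
  have hint : Integrable (F z₀) μ :=
    hg.mono' (hm z₀) (Filter.Eventually.of_forall fun x => hgb z₀ (by linarith) x)
  have hder : ∀ z ∈ ball z₀ 1, ∀ x, ‖deriv (fun z => F z x) z‖ ≤ g x := by
    intro z hz x
    have h := Complex.norm_deriv_le_of_forall_mem_sphere_norm_le (c := z) (R := 1) (C := g x)
      (f := fun z => F z x) one_pos (hd x).diffContOnCl ?_
    · simpa using h
    · intro w hw
      apply hgb
      rw [mem_ball, dist_eq_norm] at hz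
      rw [mem_sphere, dist_eq_norm] at hw
      have h1 : w = (w - z) + (z - z₀) + z₀ := by ring
      rw [h1]
      refine (norm_add₃_le).trans ?_
      linarith
  have hmeas : AEStronglyMeasurable (fun x => deriv (fun z => F z x) z₀) μ := by
    refine aestronglyMeasurable_of_tendsto_ae (u := Filter.atTop)
      (f := fun (k : ℕ) x => ((1 / ((k : ℂ) + 1)))⁻¹ • (F (z₀ + 1 / ((k : ℂ) + 1)) x - F z₀ x)) ?_ ?_
    · intro k
      exact AEStronglyMeasurable.const_smul ((hm _).sub (hm _)) ((1 / ((k : ℂ) + 1))⁻¹)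
    · refine Filter.Eventually.of_forall fun x => ?_
      have h := ((hd x) z₀).hasDerivAt.tendsto_slope_zero
      refine h.comp ?_
      rw [tendsto_nhdsWithin_iff]
      refine ⟨tendsto_one_div_add_atTop_nhds_zero_nat, Filter.Eventually.of_forall fun k => ?_⟩
      have : ((k : ℂ) + 1) ≠ 0 := by exact_mod_cast Nat.succ_ne_zero k
      simp [this]
  exact (hasDerivAt_integral_of_dominated_loc_of_deriv_le (F := F)
    (F' := fun z x => deriv (fun z => F z x) z) (ball_mem_nhds z₀ one_pos)
    (Filter.Eventually.of_forall hm) hint hmeas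
    (Filter.Eventually.of_forall fun x z hz => hder z hz x) hg
    (Filter.Eventually.of_forall fun x z hz => ((hd x) z).hasDerivAt)).2.differentiableAt

/-- Matrix of a linear map in the standard basis. -/
noncomputable def mat {n : ℕ} (f : EuclideanSpace ℝ (Fin n) →L[ℝ] EuclideanSpace ℝ (Fin n)) :
    Matrix (Fin n) (Fin n) ℝ :=
  LinearMap.toMatrix (EuclideanSpace.basisFun (Fin n) ℝ).toBasis
    (EuclideanSpace.basisFun (Fin n) ℝ).toBasis (f : EuclideanSpace ℝ (Fin n) →ₗ[ℝ] EuclideanSpace ℝ (Fin n))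

theorem mat_apply {n : ℕ} (f : EuclideanSpace ℝ (Fin n) →L[ℝ] EuclideanSpace ℝ (Fin n)) (i j : Fin n) :
    mat f i j = (f (EuclideanSpace.single j 1)) i := by
  simp [mat, LinearMap.toMatrix_apply]

theorem abs_mat_le {n : ℕ} (f : EuclideanSpace ℝ (Fin n) →L[ℝ] EuclideanSpace ℝ (Fin n)) (i j : Fin n) :
    |mat f i j| ≤ ‖f‖ := by
  rw [mat_apply]
  calc |(f (EuclideanSpace.single j 1)) i| ≤ ‖f (EuclideanSpace.single j 1)‖ := by
        simpa using PiLp.norm_apply_le (f (EuclideanSpace.single j 1)) i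
    _ ≤ ‖f‖ * ‖(EuclideanSpace.single j 1 : EuclideanSpace ℝ (Fin n))‖ := f.le_opNorm _
    _ = ‖f‖ := by simp

/-- Block linear maps on the product. -/
noncomputable def blk {n : ℕ}
    (f g h k : EuclideanSpace ℝ (Fin n) →L[ℝ] EuclideanSpace ℝ (Fin n)) :
    (EuclideanSpace ℝ (Fin n) × EuclideanSpace ℝ (Fin n)) →L[ℝ]
      (EuclideanSpace ℝ (Fin n) × EuclideanSpace ℝ (Fin n)) :=
  (f.coprod g).prod (h.coprod k)

theorem det_blk {n : ℕ}
    (f g h k : EuclideanSpace ℝ (Fin n) →L[ℝ] EuclideanSpace ℝ (Fin n)) :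
    (blk f g h k).det = (Matrix.fromBlocks (mat f) (mat g) (mat h) (mat k)).det := by
  let b := (EuclideanSpace.basisFun (Fin n) ℝ).toBasis
  rw [ContinuousLinearMap.det, ← LinearMap.det_toMatrix (b.prod b)]
  congr 1
  ext i j
  rcases i with i | i <;> rcases j with j | j <;>
    simp [LinearMap.toMatrix_apply, blk, mat_apply, b]

theorem det_mat {n : ℕ} (f : EuclideanSpace ℝ (Fin n) →L[ℝ] EuclideanSpace ℝ (Fin n)) :
    (mat f).det = f.det := by
  rw [mat, LinearMap.det_toMatrix]

theorem mat_add {n : ℕ} (f g : EuclideanSpace ℝ (Fin n) →L[ℝ] EuclideanSpace ℝ (Fin n)) :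
    mat (f + g) = mat f + mat g := by
  simp [mat]

theorem mat_smul {n : ℕ} (c : ℝ) (f : EuclideanSpace ℝ (Fin n) →L[ℝ] EuclideanSpace ℝ (Fin n)) :
    mat (c • f) = c • mat f := by
  simp [mat]

theorem mat_id {n : ℕ}  :
    mat (ContinuousLinearMap.id ℝ (EuclideanSpace ℝ (Fin n))) = 1 := by
  exact LinearMap.toMatrix_id _

end RBM

namespace RBM

/-- Euclidean space. -/
abbrev Eu (n : ℕ) := EuclideanSpace ℝ (Fin n)

/-- The complex quadratic exponent. -/
noncomputable def Qc {n : ℕ} (p : Eu n → Eu n) (z : ℂ) (x : Eu n × Eu n) : ℂ :=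
  ((‖x.1‖ ^ 2 + ‖x.2‖ ^ 2 : ℝ) : ℂ) + (z ^ 4 + z ^ 2) / 4 * ((‖p x.1‖ ^ 2 + ‖p x.2‖ ^ 2 : ℝ) : ℂ)
    - z ^ 2 * ((inner ℝ x.1 (p x.1) + inner ℝ x.2 (p x.2) : ℝ) : ℂ)
    + z * ((inner ℝ x.2 (p x.1) - inner ℝ x.1 (p x.2) : ℝ) : ℂ)

/-- The Jacobian block matrix over a ring with an algebra structure over the reals. -/
noncomputable def Mc {n : ℕ} (A B : Matrix (Fin n) (Fin n) ℝ) (z : ℂ) :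
    Matrix (Fin n ⊕ Fin n) (Fin n ⊕ Fin n) ℂ :=
  Matrix.fromBlocks (1 - (z ^ 2 / 2) • A.map ((↑) : ℝ → ℂ)) (-(z / 2) • B.map ((↑) : ℝ → ℂ))
    ((z / 2) • A.map ((↑) : ℝ → ℂ)) (1 - (z ^ 2 / 2) • B.map ((↑) : ℝ → ℂ))

/-- The Jacobian block matrix, real version. -/
noncomputable def Mr {n : ℕ} (A B : Matrix (Fin n) (Fin n) ℝ) (z : ℝ) :
    Matrix (Fin n ⊕ Fin n) (Fin n ⊕ Fin n) ℝ :=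
  Matrix.fromBlocks (1 - (z ^ 2 / 2) • A) (-(z / 2) • B) ((z / 2) • A) (1 - (z ^ 2 / 2) • B)

theorem Mc_ofReal {n : ℕ} (A B : Matrix (Fin n) (Fin n) ℝ) (z : ℝ) :
    (Mc A B (z : ℂ)).det = ((Mr A B z).det : ℝ) := by
  have h : Mc A B (z : ℂ) = (Mr A B z).map (Complex.ofRealHom) := by
    ext i j
    rcases i with i | i <;> rcases j with j | j <;>
      simp [Mc, Mr, Matrix.one_apply, apply_ite]
  rw [h]
  exact (RingHom.map_det Complex.ofRealHom (Mr A B z)).symm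

theorem Mc_I {n : ℕ} (A B : Matrix (Fin n) (Fin n) ℝ) :
    (Mc A B Complex.I).det = ((1 + (1 / 2 : ℝ) • (A + B)).det : ℝ) := by
  set A' := A.map ((↑) : ℝ → ℂ) with hA
  set B' := B.map ((↑) : ℝ → ℂ) with hB
  have h0 : Matrix.fromBlocks (1 : Matrix (Fin n) (Fin n) ℂ) (Complex.I • (1 : Matrix (Fin n) (Fin n) ℂ))
        (0 : Matrix (Fin n) (Fin n) ℂ) (1 : Matrix (Fin n) (Fin n) ℂ) * Mc A B Complex.I
      = Matrix.fromBlocks 1 (Complex.I • (1 : Matrix (Fin n) (Fin n) ℂ)) ((Complex.I / 2) • A')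
        (1 + (1 / 2 : ℂ) • B') := by
    rw [Mc, Matrix.fromBlocks_multiply]
    congr 1
    · ext i j
      simp [← hA]
      ring_nf
      simp
    · ext i j
      simp [← hB]
      ring_nf
    · ext i j
      simp [← hA]
    · ext i j
      simp [← hB]
      ring_nf
  have h1 : Matrix.fromBlocks (1 : Matrix (Fin n) (Fin n) ℂ) (0 : Matrix (Fin n) (Fin n) ℂ)
        (-(Complex.I / 2) • A') (1 : Matrix (Fin n) (Fin n) ℂ) *
      (Matrix.fromBlocks (1 : Matrix (Fin n) (Fin n) ℂ) (Complex.I • (1 : Matrix (Fin n) (Fin n) ℂ))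
        (0 : Matrix (Fin n) (Fin n) ℂ) (1 : Matrix (Fin n) (Fin n) ℂ) * Mc A B Complex.I)
      = Matrix.fromBlocks 1 (Complex.I • (1 : Matrix (Fin n) (Fin n) ℂ)) 0
        (1 + (1 / 2 : ℂ) • (A' + B')) := by
    rw [h0, Matrix.fromBlocks_multiply]
    congr 1
    · ext i j
      simp
    · ext i j
      simp
    · ext i j
      simp
    · ext i j
      simp
      ring_nf
      simp
      ring
  have h2 := congrArg Matrix.det h1
  rw [Matrix.det_mul, Matrix.det_mul, Matrix.det_fromBlocks_zero₁₂, Matrix.det_fromBlocks_zero₂₁,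
    Matrix.det_fromBlocks_zero₂₁] at h2
  simp only [Matrix.det_one, one_mul] at h2
  rw [h2]
  have h : (1 + (1 / 2 : ℂ) • (A' + B')) = (1 + (1 / 2 : ℝ) • (A + B)).map (Complex.ofRealHom) := by
    ext i j
    simp [Matrix.one_apply, apply_ite, hA, hB]
  rw [h]
  exact (RingHom.map_det Complex.ofRealHom _).symm

theorem det_Mr_pos {n : ℕ} (R : ℝ) : ∃ δ > 0, ∀ r : ℝ, |r| < δ →
    ∀ A B : Matrix (Fin n) (Fin n) ℝ, (∀ i j, |A i j| ≤ R) → (∀ i j, |B i j| ≤ R) →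
    0 < (Mr A B r).det := by
  let S : Set (Matrix (Fin n) (Fin n) ℝ) :=
    Set.pi Set.univ fun _ => Set.pi Set.univ fun _ => Set.Icc (-R) R
  have hS : IsCompact S := isCompact_univ_pi fun _ => isCompact_univ_pi fun _ => isCompact_Icc
  have h := (hS.prod hS).eventually_forall_of_forall_eventually (x₀ := (0 : ℝ))
    (P := fun r y => 0 < (Mr y.1 y.2 r).det) ?_
  · obtain ⟨δ, hδ, h⟩ := Metric.eventually_nhds_iff.1 h
    refine ⟨δ, hδ, fun r hr A B hA hB => h (by simpa using hr) (A, B) ⟨?_, ?_⟩⟩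
    · exact fun i _ j _ => abs_le.1 (hA i j)
    · exact fun i _ j _ => abs_le.1 (hB i j)
  · intro y _
    have hc : Continuous fun q : ℝ × (Matrix (Fin n) (Fin n) ℝ × Matrix (Fin n) (Fin n) ℝ) =>
        (Mr q.2.1 q.2.2 q.1).det := by
      refine Continuous.matrix_det ?_
      unfold Mr
      refine Continuous.matrix_fromBlocks ?_ ?_ ?_ ?_ <;> fun_prop
    refine hc.continuousAt.eventually (lt_mem_nhds ?_)
    simp [Mr]

theorem norm_det_Mc_le {n : ℕ} (A B : Matrix (Fin n) (Fin n) ℝ) (R r : ℝ) (hR : 0 ≤ R) (hr : 0 ≤ r)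
    (hA : ∀ i j, |A i j| ≤ R) (hB : ∀ i j, |B i j| ≤ R) (z : ℂ) (hz : ‖z‖ ≤ r) :
    ‖(Mc A B z).det‖ ≤
      (Fintype.card (Fin n ⊕ Fin n)).factorial • (1 + r ^ 2 * R + r * R) ^ (Fintype.card (Fin n ⊕ Fin n)) := by
  have hz2 : ‖z‖ ^ 2 ≤ r ^ 2 := by gcongr
  have h1 : ∀ (X : Matrix (Fin n) (Fin n) ℝ), (∀ i j, |X i j| ≤ R) → ∀ i j,
      ‖((1 : Matrix (Fin n) (Fin n) ℂ) - (z ^ 2 / 2) • X.map ((↑) : ℝ → ℂ)) i j‖ ≤ 1 + r ^ 2 * R + r * R := by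
    intro X hX i j
    have ha : ‖(1 : Matrix (Fin n) (Fin n) ℂ) i j‖ ≤ 1 := by
      rw [Matrix.one_apply]; split_ifs <;> simp
    have hb : ‖(z ^ 2 / 2) * (X i j : ℂ)‖ ≤ r ^ 2 * R := by
      rw [norm_mul, norm_div, norm_pow, Complex.norm_real, Real.norm_eq_abs]
      simp only [Complex.norm_ofNat]
      gcongr
      · nlinarith [sq_nonneg ‖z‖]
      · exact hX i j
    have : ((1 : Matrix (Fin n) (Fin n) ℂ) - (z ^ 2 / 2) • X.map ((↑) : ℝ → ℂ)) i j
      = (1 : Matrix (Fin n) (Fin n) ℂ) i j - (z ^ 2 / 2) * (X i j : ℂ) := by simp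
    rw [this]
    refine (norm_sub_le _ _).trans ?_
    have : 0 ≤ r * R := by positivity
    linarith
  have h2 : ∀ (X : Matrix (Fin n) (Fin n) ℝ), (∀ i j, |X i j| ≤ R) → ∀ i j,
      ‖(z / 2) * (X i j : ℂ)‖ ≤ 1 + r ^ 2 * R + r * R := by
    intro X hX i j
    have hb : ‖(z / 2) * (X i j : ℂ)‖ ≤ r * R := by
      rw [norm_mul, norm_div, Complex.norm_real, Real.norm_eq_abs]
      simp only [Complex.norm_ofNat]
      gcongr
      · linarith [norm_nonneg z]
      · exact hX i j
    have : 0 ≤ r ^ 2 * R := by positivity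
    linarith
  have := Matrix.det_le (A := Mc A B z) (abv := (NormedField.toAbsoluteValue ℂ))
    (x := 1 + r ^ 2 * R + r * R) ?_
  · exact this
  · intro i j
    change ‖Mc A B z i j‖ ≤ _
    rcases i with i | i <;> rcases j with j | j
    · exact h1 A hA i j
    · have := h2 B hB i j
      simpa [Mc] using this
    · have := h2 A hA i j
      simpa [Mc] using this
    · exact h1 B hB i j

end RBM

namespace RBM

theorem integrable_gauss2 {n : ℕ} (b : ℝ) (hb : 0 < b) :
    Integrable (fun x : Eu n × Eu n => Real.exp (-b * (‖x.1‖ ^ 2 + ‖x.2‖ ^ 2))) := by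
  have h1 : Integrable (fun x : Eu n => Real.exp (-b * ‖x‖ ^ 2)) := by
    have := (GaussianFourier.integrable_cexp_neg_mul_sq_norm_add (V := Eu n) (b := (b : ℂ))
      (by simpa using hb) 0 0).norm
    refine this.congr (Filter.Eventually.of_forall fun x => ?_)
    simp [Complex.norm_exp, ← Complex.ofReal_pow]
  have := h1.mul_prod h1
  refine this.congr (Filter.Eventually.of_forall fun x => ?_)
  simp only
  rw [← Real.exp_add]
  ring_nf

theorem integral_gauss2 {n : ℕ} :
    ∫ x : Eu n × Eu n, Real.exp (-(1 / 2) * (‖x.1‖ ^ 2 + ‖x.2‖ ^ 2)) = (2 * π) ^ n := by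
  have h := integral_prod_mul (μ := (volume : Measure (Eu n))) (ν := (volume : Measure (Eu n)))
    (fun x : Eu n => Real.exp (-(1 / 2) * ‖x‖ ^ 2)) (fun x : Eu n => Real.exp (-(1 / 2) * ‖x‖ ^ 2))
  rw [GaussianFourier.integral_rexp_neg_mul_sq_norm (by norm_num)] at h
  rw [← Measure.volume_eq_prod] at h
  calc _ = ∫ x : Eu n × Eu n, Real.exp (-(1 / 2) * ‖x.1‖ ^ 2) * Real.exp (-(1 / 2) * ‖x.2‖ ^ 2) := by
        congr 1; ext x; rw [← Real.exp_add]; ring_nf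
    _ = _ := by
      rw [h, ← Real.rpow_add (by positivity)]
      simp only [finrank_euclideanSpace, Fintype.card_fin, add_halves, rpow_natCast]
      congr 1
      ring

/-- The integrand. -/
noncomputable def Fc {n : ℕ} (p : Eu n → Eu n) (p' : Eu n → Eu n →L[ℝ] Eu n) (z : ℂ)
    (x : Eu n × Eu n) : ℂ :=
  Complex.exp (-(1 / 2) * Qc p z x) * (Mc (mat (p' x.1)) (mat (p' x.2)) z).det

variable {n : ℕ} {p : Eu n → Eu n} {p' : Eu n → Eu n →L[ℝ] Eu n} {R : ℝ}

theorem Fc_differentiable (x : Eu n × Eu n) : Differentiable ℂ (fun z => Fc p p' z x) := by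
  unfold Fc
  refine Differentiable.mul ?_ ?_
  · unfold Qc; fun_prop
  · simp only [Matrix.det_apply]
    refine Differentiable.fun_sum fun σ _ => ?_
    refine Differentiable.const_smul ?_ _
    refine Differentiable.fun_finsetProd fun i _ => ?_
    rcases h : σ i with k | k <;> rcases i with j | j <;> simp [Mc] <;> fun_prop

theorem continuous_mat : Continuous (mat : (Eu n →L[ℝ] Eu n) → Matrix (Fin n) (Fin n) ℝ) := by
  refine continuous_matrix fun i j => ?_
  simp only [mat_apply]
  fun_prop

theorem Fc_continuous (hp : ∀ s, HasFDerivAt p (p' s) s) (hc : Continuous p') (z : ℂ) :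
    Continuous (Fc p p' z) := by
  have hpc : Continuous p := continuous_iff_continuousAt.2 fun s => (hp s).continuousAt
  have hm : Continuous fun s => mat (p' s) := continuous_mat.comp hc
  unfold Fc
  refine Continuous.mul ?_ ?_
  · unfold Qc; fun_prop
  · refine Continuous.matrix_det ?_
    unfold Mc
    have h1 : Continuous fun x : Eu n × Eu n => (mat (p' x.1)).map ((↑) : ℝ → ℂ) :=
      (hm.comp continuous_fst).matrix_map Complex.continuous_ofReal
    have h2 : Continuous fun x : Eu n × Eu n => (mat (p' x.2)).map ((↑) : ℝ → ℂ) :=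
      (hm.comp continuous_snd).matrix_map Complex.continuous_ofReal
    refine Continuous.matrix_fromBlocks ?_ ?_ ?_ ?_ <;> fun_prop

theorem Qc_re_ge (hb : ∀ s, ‖p s‖ ≤ R) (r : ℝ) (hr : 0 ≤ r) (z : ℂ) (hz : ‖z‖ ≤ r)
    (x : Eu n × Eu n) :
    (‖x.1‖ ^ 2 + ‖x.2‖ ^ 2) / 2 - ((r ^ 4 + r ^ 2) * R ^ 2 + 2 * (r ^ 2 * R + r * R) ^ 2)
      ≤ (Qc p z x).re := by
  have hz2 : ‖z‖ ^ 2 ≤ r ^ 2 := by gcongr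
  have hz4 : ‖z‖ ^ 4 ≤ r ^ 4 := by gcongr
  obtain ⟨s, t⟩ := x
  have key : ∀ (w : ℂ) (c W D : ℝ), ‖w‖ ≤ W → |c| ≤ D → 0 ≤ W → |(w * (c : ℂ)).re| ≤ W * D := by
    intro w c W D h1 h2 h3
    refine (Complex.abs_re_le_norm _).trans ?_
    rw [norm_mul, Complex.norm_real, Real.norm_eq_abs]
    gcongr
  have e1 := key ((z ^ 4 + z ^ 2) / 4) (‖p s‖ ^ 2 + ‖p t‖ ^ 2) ((r ^ 4 + r ^ 2) / 4) (2 * R ^ 2) ?_ ?_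
    (by positivity)
  · have e2 := key (z ^ 2) (inner ℝ s (p s) + inner ℝ t (p t)) (r ^ 2) ((‖s‖ + ‖t‖) * R) ?_ ?_
      (by positivity)
    · have e3 := key z (inner ℝ t (p s) - inner ℝ s (p t)) r ((‖s‖ + ‖t‖) * R) hz ?_ hr
      · have hre : (Qc p z (s, t)).re = (‖s‖ ^ 2 + ‖t‖ ^ 2)
          + ((z ^ 4 + z ^ 2) / 4 * ((‖p s‖ ^ 2 + ‖p t‖ ^ 2 : ℝ) : ℂ)).re
          - (z ^ 2 * ((inner ℝ s (p s) + inner ℝ t (p t) : ℝ) : ℂ)).re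
          + (z * ((inner ℝ t (p s) - inner ℝ s (p t) : ℝ) : ℂ)).re := by
          simp only [Qc, Complex.add_re, Complex.sub_re, Complex.ofReal_re]
        rw [hre]
        have a1 := (abs_le.1 e1).1
        have a2 := (abs_le.1 e2).2
        have a3 := (abs_le.1 e3).1
        set m := r ^ 2 * R + r * R with hm
        have a4 : r ^ 2 * ((‖s‖ + ‖t‖) * R) + r * ((‖s‖ + ‖t‖) * R) = m * ‖s‖ + m * ‖t‖ := by
          rw [hm]; ring
        have a5 : 0 ≤ (r ^ 4 + r ^ 2) * R ^ 2 := by positivity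
        nlinarith [sq_nonneg (‖s‖ - m), sq_nonneg (‖t‖ - m), sq_nonneg m]
      · refine (abs_sub _ _).trans ?_
        have := abs_real_inner_le_norm t (p s)
        have := abs_real_inner_le_norm s (p t)
        nlinarith [hb s, hb t, norm_nonneg s, norm_nonneg t]
    · rw [norm_pow]; exact hz2
    · refine (abs_add_le _ _).trans ?_
      have := abs_real_inner_le_norm t (p t)
      have := abs_real_inner_le_norm s (p s)
      nlinarith [hb s, hb t, norm_nonneg s, norm_nonneg t]
  · rw [norm_div, Complex.norm_ofNat]
    gcongr
    refine (norm_add_le _ _).trans ?_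
    rw [norm_pow, norm_pow]
    linarith
  · rw [abs_of_nonneg (by positivity)]
    have h1 : ‖p s‖ ^ 2 ≤ R ^ 2 := by gcongr; exact hb s
    have h2 : ‖p t‖ ^ 2 ≤ R ^ 2 := by gcongr; exact hb t
    linarith

theorem Fc_bound (hR : 0 ≤ R) (hb : ∀ s, ‖p s‖ ≤ R) (hb' : ∀ s, ‖p' s‖ ≤ R) (r : ℝ) (hr : 0 < r) :
    ∃ g : Eu n × Eu n → ℝ, Integrable g ∧ ∀ z : ℂ, ‖z‖ ≤ r → ∀ x, ‖Fc p p' z x‖ ≤ g x := by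
  set D : ℝ := (Fintype.card (Fin n ⊕ Fin n)).factorial • (1 + r ^ 2 * R + r * R) ^ (Fintype.card (Fin n ⊕ Fin n)) with hD
  set c : ℝ := ((r ^ 4 + r ^ 2) * R ^ 2 + 2 * (r ^ 2 * R + r * R) ^ 2) with hc
  refine ⟨fun x => Real.exp (-(1/4) * (‖x.1‖ ^ 2 + ‖x.2‖ ^ 2)) * (Real.exp (c / 2) * D),
    (integrable_gauss2 (1/4) (by norm_num)).mul_const _, fun z hz x => ?_⟩
  unfold Fc
  beta_reduce
  rw [norm_mul, Complex.norm_exp, ← mul_assoc, ← Real.exp_add]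
  have h1 := norm_det_Mc_le (mat (p' x.1)) (mat (p' x.2)) R r hR hr.le
    (fun i j => (abs_mat_le _ i j).trans (hb' _)) (fun i j => (abs_mat_le _ i j).trans (hb' _)) z hz
  have h2 := Qc_re_ge hb r hr.le z hz x
  gcongr
  have : (-(1 / 2) * Qc p z x).re = -(1/2) * (Qc p z x).re := by
    have : (-(1 / 2) * Qc p z x) = ((-(1/2) : ℝ) : ℂ) * Qc p z x := by push_cast; ring
    rw [this, Complex.re_ofReal_mul]
  rw [this]
  linarith

/-- The real deformation of the identity. -/
noncomputable def Gr (p : Eu n → Eu n) (r : ℝ) (x : Eu n × Eu n) : Eu n × Eu n :=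
  (x.1 - (r ^ 2 / 2) • p x.1 - (r / 2) • p x.2, x.2 + (r / 2) • p x.1 - (r ^ 2 / 2) • p x.2)

theorem Qc_ofReal (r : ℝ) (x : Eu n × Eu n) :
    Qc p (r : ℂ) x = ((‖(Gr p r x).1‖ ^ 2 + ‖(Gr p r x).2‖ ^ 2 : ℝ) : ℂ) := by
  obtain ⟨s, t⟩ := x
  have : (‖(Gr p r (s, t)).1‖ ^ 2 + ‖(Gr p r (s, t)).2‖ ^ 2 : ℝ) =
    ((‖s‖ ^ 2 + ‖t‖ ^ 2 : ℝ)) + (r ^ 4 + r ^ 2) / 4 * ((‖p s‖ ^ 2 + ‖p t‖ ^ 2 : ℝ))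
    - r ^ 2 * ((inner ℝ s (p s) + inner ℝ t (p t) : ℝ))
    + r * ((inner ℝ t (p s) - inner ℝ s (p t) : ℝ)) := by
    simp only [Gr, ← real_inner_self_eq_norm_sq, inner_sub_left, inner_sub_right, inner_add_left,
      inner_add_right, inner_smul_left, inner_smul_right]
    rw [real_inner_comm s (p s), real_inner_comm s (p t), real_inner_comm t (p s), real_inner_comm t (p t),
      real_inner_comm (p s) (p t)]
    simp
    ring
  rw [this, Qc]
  push_cast
  ring

theorem Gr_hasFDerivAt (hp : ∀ s, HasFDerivAt p (p' s) s) (r : ℝ) (x : Eu n × Eu n) :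
    HasFDerivAt (Gr p r) (blk (ContinuousLinearMap.id ℝ _ - (r ^ 2 / 2) • p' x.1) (-(r / 2) • p' x.2)
      ((r / 2) • p' x.1) (ContinuousLinearMap.id ℝ _ - (r ^ 2 / 2) • p' x.2)) x := by
  have h1 : HasFDerivAt (fun x : Eu n × Eu n => x.1) (ContinuousLinearMap.fst ℝ _ _) x := hasFDerivAt_fst
  have h2 : HasFDerivAt (fun x : Eu n × Eu n => x.2) (ContinuousLinearMap.snd ℝ _ _) x := hasFDerivAt_snd
  have h3 := (hp x.1).comp x h1
  have h4 := (hp x.2).comp x h2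
  have := ((h1.sub (h3.const_smul (r ^ 2 / 2))).sub (h4.const_smul (r / 2))).prodMk
    ((h2.add (h3.const_smul (r / 2))).sub (h4.const_smul (r ^ 2 / 2)))
  refine this.congr_fderiv ?_
  ext y <;> simp [blk] 

theorem Gr_bij (hp : ∀ s, HasFDerivAt p (p' s) s) (hR : 0 ≤ R) (hb' : ∀ s, ‖p' s‖ ≤ R)
    (r : ℝ) (hr : |r| < 1) (hr' : |r| * R < 1) : Function.Bijective (Gr p r) := by
  have hlip : ∀ s t, ‖p s - p t‖ ≤ R * ‖s - t‖ := fun s t =>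
    Convex.norm_image_sub_le_of_norm_hasFDerivWithin_le (s := Set.univ)
      (fun x _ => (hp x).hasFDerivWithinAt) (fun x _ => hb' x) convex_univ trivial trivial
  have happ : ApproximatesLinearOn (Gr p r)
      ((ContinuousLinearEquiv.refl ℝ (Eu n × Eu n) : (Eu n × Eu n) ≃L[ℝ] (Eu n × Eu n)) :
        (Eu n × Eu n) →L[ℝ] (Eu n × Eu n)) Set.univ ⟨|r| * R, by positivity⟩ := by
    intro x _ y _
    have hr2 : r ^ 2 ≤ |r| := by rw [← sq_abs]; nlinarith [abs_nonneg r]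
    have hx1 : ‖x.1 - y.1‖ ≤ ‖x - y‖ := norm_fst_le (x - y)
    have hx2 : ‖x.2 - y.2‖ ≤ ‖x - y‖ := norm_snd_le (x - y)
    have e1 := hlip x.1 y.1
    have e2 := hlip x.2 y.2
    have f1 : ‖p x.1 - p y.1‖ ≤ R * ‖x - y‖ := e1.trans (by gcongr)
    have f2 : ‖p x.2 - p y.2‖ ≤ R * ‖x - y‖ := e2.trans (by gcongr)
    have g : ∀ a b : Eu n, ‖a‖ ≤ R * ‖x - y‖ → ‖b‖ ≤ R * ‖x - y‖ → 
       |r| / 2 * ‖a‖ + r ^ 2 / 2 * ‖b‖ ≤ |r| * R * ‖x - y‖ := by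
      intro a b ha hb
      calc |r| / 2 * ‖a‖ + r ^ 2 / 2 * ‖b‖ ≤ |r| / 2 * (R * ‖x - y‖) + |r| / 2 * (R * ‖x - y‖) := by gcongr
        _ = _ := by ring
    change _ ≤ |r| * R * ‖x - y‖
    rw [Prod.norm_def]
    refine max_le ?_ ?_
    · have : (Gr p r x - Gr p r y - (ContinuousLinearEquiv.refl ℝ (Eu n × Eu n) : (Eu n × Eu n) →L[ℝ] (Eu n × Eu n)) (x - y)).1
        = -((r / 2) • (p x.2 - p y.2)) - (r ^ 2 / 2) • (p x.1 - p y.1) := by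
        simp [Gr]; module
      rw [this]
      refine (norm_sub_le _ _).trans ?_
      rw [norm_neg, norm_smul, norm_smul, Real.norm_eq_abs, Real.norm_eq_abs, abs_div, abs_div, abs_two, abs_sq]
      exact g _ _ f2 f1
    · have : (Gr p r x - Gr p r y - (ContinuousLinearEquiv.refl ℝ (Eu n × Eu n) : (Eu n × Eu n) →L[ℝ] (Eu n × Eu n)) (x - y)).2
        = ((r / 2) • (p x.1 - p y.1)) - (r ^ 2 / 2) • (p x.2 - p y.2) := by
        simp [Gr]; module
      rw [this]
      refine (norm_sub_le _ _).trans ?_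
      rw [norm_smul, norm_smul, Real.norm_eq_abs, Real.norm_eq_abs, abs_div, abs_div, abs_two, abs_sq]
      exact g _ _ f1 f2
  have hcond : Subsingleton (Eu n × Eu n) ∨ (⟨|r| * R, by positivity⟩ : NNReal) <
      ‖((ContinuousLinearEquiv.refl ℝ (Eu n × Eu n)).symm : (Eu n × Eu n) →L[ℝ] (Eu n × Eu n))‖₊⁻¹ := by
    rcases subsingleton_or_nontrivial (Eu n × Eu n) with h | h
    · exact Or.inl h
    · right
      have : ‖((ContinuousLinearEquiv.refl ℝ (Eu n × Eu n)).symm : (Eu n × Eu n) →L[ℝ] (Eu n × Eu n))‖₊ = 1 := by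
        ext
        simp
      rw [this, inv_one]
      exact_mod_cast hr'
  exact ⟨Set.injOn_univ.1 (happ.injOn hcond), happ.surjective hcond⟩

theorem mat_sub {n : ℕ} (f g : EuclideanSpace ℝ (Fin n) →L[ℝ] EuclideanSpace ℝ (Fin n)) :
    mat (f - g) = mat f - mat g := by
  simp [mat]

instance haar_prod : (volume : Measure (Eu n × Eu n)).IsAddHaarMeasure := by
  rw [Measure.volume_eq_prod]; infer_instance

theorem integral_Fc_real (hp : ∀ s, HasFDerivAt p (p' s) s) (hR : 0 ≤ R) (hb' : ∀ s, ‖p' s‖ ≤ R) :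
    ∃ δ > 0, ∀ r : ℝ, |r| < δ → ∫ x, Fc p p' (r : ℂ) x = (((2 * π) ^ n : ℝ) : ℂ) := by
  obtain ⟨δ, hδ, hpos⟩ := det_Mr_pos (n := n) R
  refine ⟨min δ (1 / (1 + R)), by positivity, fun r hr => ?_⟩
  have hr1 : |r| < δ := hr.trans_le (min_le_left _ _)
  have hr2 : |r| < 1 / (1 + R) := hr.trans_le (min_le_right _ _)
  have hr3 : |r| * (1 + R) < 1 := by rwa [lt_div_iff₀ (by positivity)] at hr2
  have hbij := Gr_bij hp hR hb' r (by nlinarith [abs_nonneg r, mul_nonneg (abs_nonneg r) hR])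
    (by nlinarith [abs_nonneg r])
  have hcv := integral_image_eq_integral_abs_det_fderiv_smul (volume : Measure (Eu n × Eu n))
    (s := Set.univ) (f := Gr p r) MeasurableSet.univ
    (fun x _ => (Gr_hasFDerivAt hp r x).hasFDerivWithinAt) (hbij.injective.injOn)
    (fun x => Real.exp (-(1 / 2) * (‖x.1‖ ^ 2 + ‖x.2‖ ^ 2)))
  rw [Set.image_univ, hbij.surjective.range_eq, Measure.restrict_univ, integral_gauss2] at hcv
  rw [hcv, ← integral_complex_ofReal]
  congr 1
  ext x
  have hd : (blk (ContinuousLinearMap.id ℝ _ - (r ^ 2 / 2) • p' x.1) (-(r / 2) • p' x.2)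
      ((r / 2) • p' x.1) (ContinuousLinearMap.id ℝ _ - (r ^ 2 / 2) • p' x.2)).det
      = (Mr (mat (p' x.1)) (mat (p' x.2)) r).det := by
    rw [det_blk, Mr]
    simp only [mat_sub, mat_smul, mat_id]
  rw [hd, abs_of_pos (hpos r hr1 _ _ (fun i j => (abs_mat_le _ i j).trans (hb' _))
    (fun i j => (abs_mat_le _ i j).trans (hb' _)))]
  rw [Fc, Mc_ofReal, Qc_ofReal]
  push_cast
  rw [smul_eq_mul]
  push_cast
  ring

theorem gauss_link (hp : ∀ s, HasFDerivAt p (p' s) s) (hc : Continuous p') (hR : 0 ≤ R)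
    (hb : ∀ s, ‖p s‖ ≤ R) (hb' : ∀ s, ‖p' s‖ ≤ R) :
    Integrable (fun x : Eu n × Eu n =>
      Real.exp (-(1 / 2) * (inner ℝ x.1 (x.1 + p x.1) + inner ℝ x.2 (x.2 + p x.2)))
        * |(1 + (1 / 2 : ℝ) • (mat (p' x.1) + mat (p' x.2))).det|) ∧
    (2 * π) ^ n ≤ ∫ x : Eu n × Eu n,
      Real.exp (-(1 / 2) * (inner ℝ x.1 (x.1 + p x.1) + inner ℝ x.2 (x.2 + p x.2)))
        * |(1 + (1 / 2 : ℝ) • (mat (p' x.1) + mat (p' x.2))).det| := by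
  have hent : Differentiable ℂ (fun z => ∫ x, Fc p p' z x) :=
    entire_integral _ Fc_differentiable (fun z => (Fc_continuous hp hc z).aestronglyMeasurable)
      (Fc_bound hR hb hb')
  obtain ⟨δ, hδ, hreal⟩ := integral_Fc_real hp hR hb'
  have heq : (fun z => ∫ x, Fc p p' z x) = fun _ => (((2 * π) ^ n : ℝ) : ℂ) := by
    refine AnalyticOnNhd.eq_of_frequently_eq (z₀ := 0)
      (fun z _ => hent.analyticAt z) (fun z _ => analyticAt_const) ?_
    have ht : Filter.Tendsto (fun k : ℕ => (((1 / ((k : ℝ) + 1)) : ℝ) : ℂ)) Filter.atTop (nhdsWithin 0 {0}ᶜ) := by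
      rw [tendsto_nhdsWithin_iff]
      constructor
      · have := (Complex.continuous_ofReal.tendsto 0).comp tendsto_one_div_add_atTop_nhds_zero_nat
        rw [Complex.ofReal_zero] at this
        exact this
      · refine Filter.Eventually.of_forall fun k => ?_
        have : ((k : ℂ) + 1) ≠ 0 := by exact_mod_cast Nat.succ_ne_zero k
        simp [this]
    refine ht.frequently (Filter.Eventually.frequently ?_)
    have := (tendsto_one_div_add_atTop_nhds_zero_nat (𝕜 := ℝ)).eventually (gt_mem_nhds hδ)
    filter_upwards [this] with k hk
    refine hreal _ ?_
    rw [abs_of_nonneg (by positivity)]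
    exact hk
  have hI := congrFun heq Complex.I
  have hnorm : ∀ x : Eu n × Eu n, ‖Fc p p' Complex.I x‖ = 
      Real.exp (-(1 / 2) * (inner ℝ x.1 (x.1 + p x.1) + inner ℝ x.2 (x.2 + p x.2)))
        * |(1 + (1 / 2 : ℝ) • (mat (p' x.1) + mat (p' x.2))).det| := by
    intro x
    rw [Fc, norm_mul, Mc_I, Complex.norm_real, Real.norm_eq_abs, Complex.norm_exp]
    congr 2
    have hI4 : Complex.I ^ 4 = 1 := by rw [show (4 : ℕ) = 2 * 2 from rfl, pow_mul, Complex.I_sq]; norm_num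
    have h2 : (-(1 / 2) * Qc p Complex.I x) = ((-(1/2) : ℝ) : ℂ) * Qc p Complex.I x := by push_cast; ring
    rw [h2, Complex.re_ofReal_mul, Qc, hI4, Complex.I_sq]
    simp only [Complex.add_re, Complex.sub_re, Complex.ofReal_re, Complex.I_mul_re, Complex.ofReal_im,
      inner_add_right, real_inner_self_eq_norm_sq]
    simp
    ring
  obtain ⟨g, hg, hgb⟩ := Fc_bound hR hb hb' 1 one_pos
  have hint : Integrable (Fc p p' Complex.I) :=
    hg.mono' (Fc_continuous hp hc _).aestronglyMeasurable
      (Filter.Eventually.of_forall fun x => hgb _ (by simp) x)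
  refine ⟨hint.norm.congr (Filter.Eventually.of_forall hnorm), ?_⟩
  have := norm_integral_le_integral_norm (μ := volume) (Fc p p' Complex.I)
  rw [hI, Complex.norm_real, Real.norm_eq_abs, abs_of_nonneg (by positivity)] at this
  simpa only [hnorm] using this

end RBM

namespace RBM

variable {n : ℕ} {K : Set (Eu n)}

/-- Laplace-type integrals over `K`. -/
noncomputable def lap {V : Type*} [NormedAddCommGroup V] [NormedSpace ℝ V]
    (K : Set (Eu n)) (f : Eu n → V) (x : Eu n) : V :=
  ∫ y in K, Real.exp (inner ℝ x y) • f y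

theorem lap_integrable {V : Type*} [NormedAddCommGroup V] [NormedSpace ℝ V]
    [FiniteDimensional ℝ V]
    (hK : IsCompact K) {f : Eu n → V} (hf : Continuous f) (x : Eu n) :
    IntegrableOn (fun y => Real.exp (inner ℝ x y) • f y) K := by
  have : Continuous (fun y => Real.exp (inner ℝ x y) • f y) := by fun_prop
  exact this.continuousOn.integrableOn_compact hK

/-- Derivative kernel. -/
noncomputable def dker {V : Type*} [NormedAddCommGroup V] [NormedSpace ℝ V]
    (f : Eu n → V) (y : Eu n) : Eu n →L[ℝ] V := (innerSL ℝ y).smulRight (f y)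

theorem dker_continuous {V : Type*} [NormedAddCommGroup V] [NormedSpace ℝ V]
    {f : Eu n → V} (hf : Continuous f) : Continuous (dker f) := by
  unfold dker
  exact ((ContinuousLinearMap.smulRightL ℝ (Eu n) V).continuous.comp (innerSL ℝ).continuous).clm_apply hf

theorem lap_hasFDerivAt {V : Type*} [NormedAddCommGroup V] [NormedSpace ℝ V]
    [FiniteDimensional ℝ V]
    (hK : IsCompact K) {f : Eu n → V} (hf : Continuous f) (x : Eu n) :
    HasFDerivAt (lap K f) (lap K (dker f) x) x := by
  obtain ⟨D, hD⟩ := hK.isBounded.exists_norm_le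
  obtain ⟨M, hM⟩ := (hK.image (dker_continuous hf)).isBounded.exists_norm_le
  have hm : ∀ x : Eu n, Continuous fun y => Real.exp (inner ℝ x y) • f y := fun x => by fun_prop
  have hm' : Continuous fun y => Real.exp (inner ℝ x y) • dker f y :=
    Continuous.smul (f := fun y : Eu n => Real.exp (inner ℝ x y)) (by fun_prop) (dker_continuous hf)
  refine hasFDerivAt_integral_of_dominated_of_fderiv_le (s := ball x 1)
    (bound := fun _ => Real.exp ((‖x‖ + 1) * D) * M)
    (F' := fun x y => Real.exp (inner ℝ x y) • dker f y) (ball_mem_nhds x one_pos)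
    (Filter.Eventually.of_forall fun x => (hm x).aestronglyMeasurable)
    (lap_integrable hK hf x) hm'.aestronglyMeasurable ?_ ?_ ?_
  · refine (ae_restrict_iff' hK.measurableSet).2 (Filter.Eventually.of_forall fun y hy z hz => ?_)
    have h1 : ‖z‖ ≤ ‖x‖ + 1 := by
      rw [mem_ball, dist_eq_norm] at hz
      have : z = (z - x) + x := by abel
      rw [this]
      exact (norm_add_le _ _).trans (by linarith)
    have h2 : inner ℝ z y ≤ (‖x‖ + 1) * D := (real_inner_le_norm z y).trans (by
      have := hD y hy
      gcongr)
    rw [norm_smul, Real.norm_eq_abs, abs_of_pos (Real.exp_pos _)]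
    have := hM _ (Set.mem_image_of_mem _ hy)
    gcongr
  · haveI : IsFiniteMeasure (volume.restrict K) := ⟨by simpa using hK.measure_lt_top⟩
    exact integrable_const _
  · refine Filter.Eventually.of_forall fun y z hz => ?_
    have h1 : HasFDerivAt (fun z : Eu n => inner ℝ z y) (innerSL ℝ y) z := by
      have : (fun z : Eu n => inner ℝ z y) = fun z => innerSL ℝ y z := by
        ext z; simp [real_inner_comm]
      rw [this]
      exact (innerSL ℝ y).hasFDerivAt
    have h2 := (h1.exp).smul_const (f y)
    refine h2.congr_fderiv ?_
    ext u
    simp [dker, smul_smul]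

theorem lap_continuous {V : Type*} [NormedAddCommGroup V] [NormedSpace ℝ V]
    [FiniteDimensional ℝ V]
    (hK : IsCompact K) {f : Eu n → V} (hf : Continuous f) : Continuous (lap K f) :=
  continuous_iff_continuousAt.2 fun x => (lap_hasFDerivAt hK hf x).continuousAt

/-- Laplace transform. -/
noncomputable def mm (K : Set (Eu n)) (x : Eu n) : ℝ := lap K (fun _ => (1 : ℝ)) x
/-- first moment -/
noncomputable def vv (K : Set (Eu n)) (x : Eu n) : Eu n := lap K (fun y => y) x
/-- barycenter -/
noncomputable def gg (K : Set (Eu n)) (x : Eu n) : Eu n := (mm K x)⁻¹ • vv K x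
/-- covariance operator -/
noncomputable def gg' (K : Set (Eu n)) (x : Eu n) : Eu n →L[ℝ] Eu n :=
  (mm K x)⁻¹ • lap K (dker fun y => y) x - (innerSL ℝ (gg K x)).smulRight (gg K x)

theorem mm_eq (x : Eu n) : mm K x = ∫ y in K, Real.exp (inner ℝ x y) := by
  simp [mm, lap]

theorem mm_integrable (hK : IsCompact K) (x : Eu n) :
    IntegrableOn (fun y => Real.exp (inner ℝ x y)) K := by
  have := lap_integrable hK (f := fun _ => (1 : ℝ)) continuous_const x
  simpa using this

theorem mm_pos (hK : IsCompact K) (hv : 0 < volume K) (x : Eu n) : 0 < mm K x := by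
  rw [mm_eq]
  refine (setIntegral_pos_iff_support_of_nonneg_ae ?_ (mm_integrable hK x)).2 ?_
  · exact Filter.Eventually.of_forall fun y => (Real.exp_pos _).le
  · have : (Function.support fun y : Eu n => Real.exp (inner ℝ x y)) = Set.univ := by
      ext y; simp [Real.exp_ne_zero]
    rwa [this, Set.univ_inter]

theorem inner_vv (hK : IsCompact K) (x u : Eu n) :
    inner ℝ u (vv K x) = ∫ y in K, Real.exp (inner ℝ x y) * inner ℝ u y := by
  have h := (innerSL ℝ u).integral_comp_comm (lap_integrable hK (f := fun y => y) continuous_id x)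
  simp only [innerSL_apply_apply, inner_smul_right] at h
  rw [h]; rfl

theorem vv_eq (hK : IsCompact K) (hv : 0 < volume K) (x : Eu n) : vv K x = mm K x • gg K x := by
  rw [gg, smul_smul, mul_inv_cancel₀ (mm_pos hK hv x).ne', one_smul]

theorem inner_dd (hK : IsCompact K) (x u w : Eu n) :
    inner ℝ w (lap K (dker fun y => y) x u) =
      ∫ y in K, Real.exp (inner ℝ x y) * (inner ℝ u y * inner ℝ w y) := by
  have h := ((innerSL ℝ w).comp (ContinuousLinearMap.apply ℝ (Eu n) u)).integral_comp_comm
    (lap_integrable hK (f := dker fun y => y) (dker_continuous continuous_id) x)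
  simp only [ContinuousLinearMap.comp_apply, ContinuousLinearMap.apply_apply, innerSL_apply_apply, 
    _root_.smul_apply, inner_smul_right, dker, ContinuousLinearMap.smulRight_apply] at h
  rw [lap]
  unfold dker
  rw [← h]
  congr 1
  ext y
  rw [real_inner_comm u y]

theorem gg_mem (hK : IsCompact K) (hc : Convex ℝ K) (hv : 0 < volume K) (x : Eu n) : gg K x ∈ K := by
  by_contra hn
  obtain ⟨f, u, h1, h2⟩ := geometric_hahn_banach_closed_point hc hK.isClosed hn
  have h3 := f.integral_comp_comm (lap_integrable hK (f := fun y => y) continuous_id x)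
  have h4 : f (vv K x) ≤ u * mm K x := by
    rw [vv, lap, ← h3, mm_eq, ← integral_const_mul]
    refine setIntegral_mono_on (f.integrable_comp (lap_integrable hK continuous_id x))
      ((mm_integrable hK x).const_mul u) hK.measurableSet fun y hy => ?_
    rw [map_smul, smul_eq_mul, mul_comm]
    have := (h1 y hy).le
    gcongr
  rw [vv_eq hK hv, map_smul, smul_eq_mul] at h4
  have := mm_pos hK hv x
  nlinarith

theorem mm_jensen (hK : IsCompact K) (hv : 0 < volume K) (s t : Eu n) :
    mm K s * Real.exp (inner ℝ (t - s) (gg K s)) ≤ mm K t := by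
  set c := inner ℝ (t - s) (gg K s) with hc
  have h1 : ∫ y in K, (Real.exp c * (1 - c)) * Real.exp (inner ℝ s y)
      + Real.exp c * (Real.exp (inner ℝ s y) * inner ℝ (t - s) y) ≤ mm K t := by
    rw [mm_eq]
    have hcont : Continuous fun y : Eu n => (Real.exp c * (1 - c)) * Real.exp (inner ℝ s y)
      + Real.exp c * (Real.exp (inner ℝ s y) * inner ℝ (t - s) y) := by fun_prop
    refine setIntegral_mono_on (hcont.continuousOn.integrableOn_compact hK)
      (mm_integrable hK t) hK.measurableSet fun y hy => ?_
    have e1 : inner ℝ t y = inner ℝ s y + inner ℝ (t - s) y := by rw [inner_sub_left]; ring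
    set a := inner ℝ (t - s) y
    have e2 : Real.exp (inner ℝ t y) = Real.exp (inner ℝ s y) * (Real.exp c * Real.exp (a - c)) := by
      rw [e1, ← Real.exp_add, ← Real.exp_add]; ring_nf
    rw [e2]
    have e3 := Real.add_one_le_exp (a - c)
    calc _ = Real.exp (inner ℝ s y) * (Real.exp c * ((a - c) + 1)) := by ring
      _ ≤ _ := by gcongr
  have hcont2 : Continuous fun y : Eu n => Real.exp c * (Real.exp (inner ℝ s y) * inner ℝ (t - s) y) := by
    fun_prop
  rw [integral_add ((mm_integrable hK s).const_mul _) (hcont2.continuousOn.integrableOn_compact hK),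
    integral_const_mul, integral_const_mul, ← inner_vv hK, ← mm_eq, vv_eq hK hv, inner_smul_right, ← hc] at h1
  linarith

theorem gg_hasFDerivAt (hK : IsCompact K) (hv : 0 < volume K) (x : Eu n) :
    HasFDerivAt (gg K) (gg' K x) x := by
  have h1 : HasFDerivAt (mm K) _ x := lap_hasFDerivAt hK (f := fun _ => (1 : ℝ)) continuous_const x
  have h2 : HasFDerivAt (vv K) _ x := lap_hasFDerivAt hK (f := fun y => y) continuous_id x
  have hm := (mm_pos hK hv x).ne'
  have h3 := ((hasDerivAt_inv hm).comp_hasFDerivAt x h1).smul h2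
  refine h3.congr_fderiv ?_
  have hl : ∀ u, lap K (dker fun _ => (1 : ℝ)) x u = inner ℝ u (vv K x) := by
    intro u
    have h := (ContinuousLinearMap.apply ℝ ℝ u).integral_comp_comm
      (lap_integrable hK (f := dker (n := n) fun _ => (1 : ℝ)) (dker_continuous continuous_const) x)
    rw [inner_vv hK]
    simp only [ContinuousLinearMap.apply_apply] at h
    rw [lap, ← h]
    congr 1
    ext y
    simp [dker, real_inner_comm]
  ext1 u
  simp only [gg', _root_.add_apply, _root_.sub_apply,
    _root_.smul_apply, ContinuousLinearMap.smulRight_apply, hl, innerSL_apply_apply,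
    Function.comp]
  rw [vv_eq hK hv, inner_smul_right, smul_smul, sub_eq_add_neg, ← neg_smul]
  congr 2
  simp only [smul_eq_mul]
  rw [real_inner_comm]
  field_simp

theorem gg'_continuous (hK : IsCompact K) (hv : 0 < volume K) : Continuous (gg' K) := by
  have h1 : Continuous (mm K) := lap_continuous hK (f := fun _ => (1 : ℝ)) continuous_const
  have h2 : Continuous (lap K (dker fun y : Eu n => y)) := lap_continuous hK (dker_continuous continuous_id)
  have h3 : Continuous (gg K) :=
    continuous_iff_continuousAt.2 fun x => (gg_hasFDerivAt hK hv x).continuousAt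
  have h4 : Continuous fun x => (mm K x)⁻¹ := h1.inv₀ fun x => (mm_pos hK hv x).ne'
  unfold gg'
  exact (h4.smul h2).sub (((ContinuousLinearMap.smulRightL ℝ (Eu n) (Eu n)).continuous.comp
    ((innerSL ℝ).continuous.comp h3)).clm_apply h3)

theorem inner_gg' (hK : IsCompact K) (x u w : Eu n) :
    inner ℝ w (gg' K x u) = (mm K x)⁻¹ * (∫ y in K, Real.exp (inner ℝ x y) * (inner ℝ u y * inner ℝ w y))
      - inner ℝ u (gg K x) * inner ℝ w (gg K x) := by
  simp only [gg', _root_.sub_apply, _root_.smul_apply, inner_sub_right,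
    inner_smul_right, inner_dd hK, ContinuousLinearMap.smulRight_apply, innerSL_apply_apply]
  rw [real_inner_comm u]

theorem gg'_symm (hK : IsCompact K) (x u w : Eu n) :
    inner ℝ w (gg' K x u) = inner ℝ u (gg' K x w) := by
  rw [inner_gg' hK, inner_gg' hK, mul_comm (inner ℝ u (gg K x))]
  simp only [mul_comm (inner ℝ u _)]

theorem gg'_var (hK : IsCompact K) (hv : 0 < volume K) (x u : Eu n) :
    mm K x * inner ℝ u (gg' K x u) =
      ∫ y in K, Real.exp (inner ℝ x y) * (inner ℝ u (y - gg K x)) ^ 2 := by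
  have hm := (mm_pos hK hv x).ne'
  set a := inner ℝ u (gg K x) with ha
  have h1 : ∫ y in K, Real.exp (inner ℝ x y) * (inner ℝ u (y - gg K x)) ^ 2
    = ∫ y in K, (Real.exp (inner ℝ x y) * (inner ℝ u y * inner ℝ u y)
      + (-2 * a) * (Real.exp (inner ℝ x y) * inner ℝ u y) + a ^ 2 * Real.exp (inner ℝ x y)) := by
    congr 1
    ext y
    rw [inner_sub_right, ← ha]
    ring
  have c1 : Continuous fun y : Eu n => Real.exp (inner ℝ x y) * (inner ℝ u y * inner ℝ u y) := by fun_prop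
  have c2 : Continuous fun y : Eu n => (-2 * a) * (Real.exp (inner ℝ x y) * inner ℝ u y) := by fun_prop
  have c3 : Continuous fun y : Eu n => a ^ 2 * Real.exp (inner ℝ x y) := by fun_prop
  rw [h1, integral_add, integral_add, integral_const_mul, integral_const_mul, ← inner_vv hK, ← mm_eq,
    vv_eq hK hv, inner_smul_right, ← ha, inner_gg' hK, ← ha]
  · field_simp; ring
  · exact c1.continuousOn.integrableOn_compact hK
  · exact c2.continuousOn.integrableOn_compact hK
  · exact (c1.add c2).continuousOn.integrableOn_compact hK
  · exact c3.continuousOn.integrableOn_compact hK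

theorem gg'_nonneg (hK : IsCompact K) (hv : 0 < volume K) (x u : Eu n) :
    0 ≤ inner ℝ u (gg' K x u) := by
  have h := gg'_var hK hv x u
  have h2 : 0 ≤ ∫ y in K, Real.exp (inner ℝ x y) * (inner ℝ u (y - gg K x)) ^ 2 :=
    integral_nonneg fun y => by positivity
  rw [← h] at h2
  exact nonneg_of_mul_nonneg_right h2 (mm_pos hK hv x)

theorem gg'_bound (hK : IsCompact K) (hc : Convex ℝ K) (hv : 0 < volume K) {D : ℝ}
    (hD0 : 0 ≤ D) (hD : ∀ y ∈ K, ‖y‖ ≤ D) (x : Eu n) : ‖gg' K x‖ ≤ 2 * D ^ 2 := by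
  have hm := mm_pos hK hv x
  unfold gg'
  refine (norm_sub_le _ _).trans ?_
  have h1 : ‖(innerSL ℝ (gg K x)).smulRight (gg K x)‖ ≤ D ^ 2 := by
    rw [ContinuousLinearMap.norm_smulRight_apply, innerSL_apply_norm]
    have := hD _ (gg_mem hK hc hv x)
    nlinarith [norm_nonneg (gg K x)]
  have h2 : ‖lap K (dker fun y => y) x‖ ≤ D ^ 2 * mm K x := by
    rw [lap, mm_eq, ← integral_const_mul]
    refine norm_integral_le_of_norm_le ((mm_integrable hK x).const_mul _) ?_
    refine (ae_restrict_iff' hK.measurableSet).2 (Filter.Eventually.of_forall fun y hy => ?_)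
    rw [norm_smul, dker, ContinuousLinearMap.norm_smulRight_apply, innerSL_apply_norm,
      Real.norm_eq_abs, abs_of_pos (Real.exp_pos _), mul_comm]
    have := hD _ hy
    gcongr
    nlinarith [norm_nonneg y]
  rw [norm_smul, norm_inv, Real.norm_eq_abs, abs_of_pos hm]
  have : (mm K x)⁻¹ * ‖lap K (dker fun y => y) x‖ ≤ D ^ 2 := by
    rw [inv_mul_le_iff₀ hm]; linarith
  linarith

theorem gg_zero (hs : -K = K) : gg K 0 = 0 := by
  have : vv K 0 = - vv K 0 := by
    conv_lhs => rw [vv, lap]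
    rw [vv, lap, ← integral_neg]
    have h := (Measure.measurePreserving_neg (volume : Measure (Eu n))).setIntegral_preimage_emb
      (MeasurableEquiv.neg (Eu n)).measurableEmbedding (fun y => Real.exp (inner ℝ 0 y) • y) K
    rw [← h]
    have : (Neg.neg ⁻¹' K : Set (Eu n)) = K := hs
    rw [this]
    congr 1
    ext1 y
    simp
  have h0 : vv K 0 = 0 := by
    have h2 : (2 : ℝ) • vv K 0 = 0 := by
      rw [two_smul]; nth_rewrite 1 [this]; simp
    simpa using h2
  rw [gg, h0, smul_zero]

end RBM

namespace RBM

variable {n : ℕ} {K : Set (Eu n)}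

/-- normalised logarithmic Laplace transform -/
noncomputable def lam (K : Set (Eu n)) (x : Eu n) : ℝ := Real.log (mm K x) - Real.log (mm K 0)

theorem lam_zero : lam K 0 = 0 := by simp [lam]

theorem lam_sub (hK : IsCompact K) (hv : 0 < volume K) (s t : Eu n) :
    lam K s + inner ℝ (t - s) (gg K s) ≤ lam K t := by
  have h := mm_jensen hK hv s t
  have h1 := Real.log_le_log (by have := mm_pos hK hv s; positivity) h
  rw [Real.log_mul (mm_pos hK hv s).ne' (Real.exp_pos _).ne', Real.log_exp] at h1
  unfold lam
  linarith

theorem lam_nonneg (hK : IsCompact K) (hv : 0 < volume K) (hs : -K = K) (x : Eu n) : 0 ≤ lam K x := by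
  have := lam_sub hK hv 0 x
  rw [gg_zero hs, lam_zero] at this
  simpa using this

theorem lam_le (hK : IsCompact K) (hv : 0 < volume K) (s : Eu n) :
    lam K s ≤ inner ℝ s (gg K s) := by
  have := lam_sub hK hv s 0
  rw [lam_zero, zero_sub, inner_neg_left] at this
  linarith

theorem lam_mid (hK : IsCompact K) (hv : 0 < volume K) (s t : Eu n) :
    lam K ((1 / 2 : ℝ) • (s + t)) ≤ (lam K s + lam K t) / 2 := by
  set c := (1 / 2 : ℝ) • (s + t) with hc
  have h1 := lam_sub hK hv c s
  have h2 := lam_sub hK hv c t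
  have h3 : (t - c) = - (s - c) := by rw [hc]; module
  rw [h3, inner_neg_left] at h2
  linarith

theorem gg_mono (hK : IsCompact K) (hv : 0 < volume K) (s t : Eu n) :
    0 ≤ inner ℝ (s - t) (gg K s - gg K t) := by
  have h1 := lam_sub hK hv s t
  have h2 := lam_sub hK hv t s
  rw [inner_sub_right]
  have h3 : t - s = -(s - t) := by abel
  rw [h3, inner_neg_left] at h1
  linarith

theorem lam_continuous (hK : IsCompact K) (hv : 0 < volume K) : Continuous (lam K) := by
  have h1 : Continuous (mm K) := lap_continuous hK (f := fun _ => (1 : ℝ)) continuous_const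
  exact (h1.log fun x => (mm_pos hK hv x).ne').sub continuous_const

/-- regularised potential -/
noncomputable def phi (K : Set (Eu n)) (x : Eu n) : ℝ := ‖x‖ ^ 2 / 2 + lam K x

theorem phi_continuous (hK : IsCompact K) (hv : 0 < volume K) : Continuous (phi K) := by
  have := lam_continuous hK hv
  unfold phi
  fun_prop

/-- The splitting map. -/
noncomputable def Psi (K : Set (Eu n)) (x : Eu n × Eu n) : Eu n × Eu n :=
  ((1 / 2 : ℝ) • (x.1 + x.2), (1 / 2 : ℝ) • ((x.1 + gg K x.1) - (x.2 + gg K x.2)))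

theorem Psi_inj (hK : IsCompact K) (hv : 0 < volume K) : Function.Injective (Psi K) := by
  rintro ⟨s, t⟩ ⟨s', t'⟩ h
  simp only [Psi, Prod.mk.injEq] at h
  have h12 : (1 / 2 : ℝ) ≠ 0 := by norm_num
  have h1 := smul_right_injective _ h12 h.1
  have h2 := smul_right_injective _ h12 h.2
  have ht : t - t' = -(s - s') := by
    have : t = s' + t' - s := by rw [← h1]; abel
    rw [this]; abel
  have e1 := gg_mono hK hv s s'
  have e2 := gg_mono hK hv t t'
  rw [ht, inner_neg_left] at e2
  have e3 : gg K s - gg K s' = (gg K t - gg K t') - (2 : ℝ) • (s - s') := by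
    have h5 : gg K s = (s' + gg K s' - (t' + gg K t')) + (t + gg K t) - s := by rw [← h2]; abel
    have h6 : t = t' - (s - s') := by rw [sub_eq_add_neg, ← ht]; abel
    rw [h5]
    nth_rewrite 1 [h6]
    module
  rw [e3, inner_sub_right, inner_smul_right, real_inner_self_eq_norm_sq] at e1
  have e4 : ‖s - s'‖ = 0 := by nlinarith [norm_nonneg (s - s')]
  have e5 : s = s' := by rwa [norm_eq_zero, sub_eq_zero] at e4
  subst e5
  simp only [sub_self, neg_zero, sub_eq_zero] at ht
  rw [ht]

theorem Psi_hasFDerivAt (hK : IsCompact K) (hv : 0 < volume K) (x : Eu n × Eu n) :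
    HasFDerivAt (Psi K) (blk ((1 / 2 : ℝ) • ContinuousLinearMap.id ℝ _) ((1 / 2 : ℝ) • ContinuousLinearMap.id ℝ _)
      ((1 / 2 : ℝ) • (ContinuousLinearMap.id ℝ _ + gg' K x.1))
      ((-(1 / 2) : ℝ) • (ContinuousLinearMap.id ℝ _ + gg' K x.2))) x := by
  have h1 : HasFDerivAt (fun x : Eu n × Eu n => x.1) (ContinuousLinearMap.fst ℝ _ _) x := hasFDerivAt_fst
  have h2 : HasFDerivAt (fun x : Eu n × Eu n => x.2) (ContinuousLinearMap.snd ℝ _ _) x := hasFDerivAt_snd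
  have h3 := (gg_hasFDerivAt hK hv x.1).comp x h1
  have h4 := (gg_hasFDerivAt hK hv x.2).comp x h2
  have := ((h1.add h2).const_smul (1 / 2 : ℝ)).prodMk
    (((h1.add h3).sub (h2.add h4)).const_smul (1 / 2 : ℝ))
  refine this.congr_fderiv ?_
  ext y <;> simp [blk]
  ring

theorem Psi_det (A B : Eu n →L[ℝ] Eu n) :
    |(blk ((1 / 2 : ℝ) • ContinuousLinearMap.id ℝ _) ((1 / 2 : ℝ) • ContinuousLinearMap.id ℝ _)
      ((1 / 2 : ℝ) • (ContinuousLinearMap.id ℝ _ + A))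
      ((-(1 / 2) : ℝ) • (ContinuousLinearMap.id ℝ _ + B))).det| * 2 ^ n =
    |(1 + (1 / 2 : ℝ) • (mat A + mat B)).det| := by
  rw [det_blk]
  simp only [mat_smul, mat_add, mat_id]
  have h : Matrix.fromBlocks ((1 / 2 : ℝ) • (1 : Matrix (Fin n) (Fin n) ℝ)) ((1 / 2 : ℝ) • (1 : Matrix (Fin n) (Fin n) ℝ))
      ((1 / 2 : ℝ) • (1 + mat A)) ((-(1 / 2) : ℝ) • (1 + mat B)) =
      Matrix.fromBlocks (1 : Matrix (Fin n) (Fin n) ℝ) 0 (1 + mat A) (1 : Matrix (Fin n) (Fin n) ℝ) *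
      Matrix.fromBlocks ((1 / 2 : ℝ) • (1 : Matrix (Fin n) (Fin n) ℝ)) ((1 / 2 : ℝ) • (1 : Matrix (Fin n) (Fin n) ℝ))
        0 ((-1 : ℝ) • (1 + (1 / 2 : ℝ) • (mat A + mat B))) := by
    rw [Matrix.fromBlocks_multiply]
    congr 1
    · simp
    · simp
    · simp
    · ext i j
      simp
      ring
  rw [h, Matrix.det_mul, Matrix.det_fromBlocks_zero₁₂, Matrix.det_fromBlocks_zero₂₁, Matrix.det_smul,
    Matrix.det_smul]
  simp only [Matrix.det_one, Fintype.card_fin, abs_mul, abs_pow]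
  norm_num
  rw [mul_right_comm, ← mul_pow]
  norm_num

theorem Psi_exp (hK : IsCompact K) (hc : Convex ℝ K) (hv : 0 < volume K) (hs : -K = K) (s t : Eu n) :
    phi K (Psi K (s, t)).1 + (infDist (Psi K (s, t)).2 K) ^ 2 / 2 ≤
      (1 / 2) * (inner ℝ s (s + gg K s) + inner ℝ t (t + gg K t)) := by
  have h1 := lam_mid hK hv s t
  have h2 := lam_le hK hv s
  have h3 := lam_le hK hv t
  have hmem : (1 / 2 : ℝ) • (gg K s - gg K t) ∈ K := by
    have ha := gg_mem hK hc hv s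
    have hb : -gg K t ∈ K := hs.subset (Set.neg_mem_neg.2 (gg_mem hK hc hv t))
    have := hc ha hb (a := 1/2) (b := 1/2) (by norm_num) (by norm_num) (by norm_num)
    rwa [← smul_add, ← sub_eq_add_neg] at this
  have h4 : infDist (Psi K (s, t)).2 K ≤ ‖s - t‖ / 2 := by
    refine (infDist_le_dist_of_mem hmem).trans ?_
    rw [dist_eq_norm]
    have : (Psi K (s, t)).2 - (1 / 2 : ℝ) • (gg K s - gg K t) = (1 / 2 : ℝ) • (s - t) := by
      simp only [Psi]; module
    rw [this, norm_smul]
    norm_num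
    linarith
  have h5 : (infDist (Psi K (s, t)).2 K) ^ 2 ≤ (‖s - t‖ / 2) ^ 2 := by
    gcongr
    exact infDist_nonneg
  have h6 : phi K (Psi K (s, t)).1 = ‖s + t‖ ^ 2 / 8 + lam K ((1 / 2 : ℝ) • (s + t)) := by
    simp only [phi, Psi, norm_smul, mul_pow]
    norm_num
    ring
  have h7 := parallelogram_law_with_norm ℝ s t
  rw [h6, inner_add_right, inner_add_right, real_inner_self_eq_norm_sq, real_inner_self_eq_norm_sq]
  nlinarith [sq_nonneg ‖s‖, sq_nonneg ‖t‖]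

theorem rsantalo (hK : IsCompact K) (hc : Convex ℝ K) (hv : 0 < volume K) (hs : -K = K) :
    ENNReal.ofReal (π ^ n) ≤ (∫⁻ x : Eu n, ENNReal.ofReal (Real.exp (-phi K x))) *
      ∫⁻ y : Eu n, ENNReal.ofReal (Real.exp (-(infDist y K ^ 2 / 2))) := by
  obtain ⟨D, hD⟩ := hK.isBounded.exists_norm_le
  have hD0 : 0 ≤ D := (norm_nonneg _).trans (hD _ (gg_mem hK hc hv 0))
  obtain ⟨hint, hle⟩ := gauss_link (p := gg K) (p' := gg' K) (R := D + 2 * D ^ 2) (gg_hasFDerivAt hK hv)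
    (gg'_continuous hK hv) (by positivity)
    (fun s => (hD _ (gg_mem hK hc hv s)).trans (by nlinarith [sq_nonneg D]))
    (fun s => (gg'_bound hK hc hv hD0 hD s).trans (by linarith))
  have h1 := ENNReal.ofReal_le_ofReal hle
  rw [ofReal_integral_eq_lintegral_ofReal hint
    (Filter.Eventually.of_forall fun x => by positivity)] at h1
  set Hf : Eu n × Eu n → ENNReal := fun x => ENNReal.ofReal (Real.exp (-phi K x.1)) *
    ENNReal.ofReal (Real.exp (-(infDist x.2 K ^ 2 / 2))) with hH
  have hcv := lintegral_image_eq_lintegral_abs_det_fderiv_mul (volume : Measure (Eu n × Eu n))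
    (s := Set.univ) (f := Psi K) MeasurableSet.univ
    (fun x _ => (Psi_hasFDerivAt hK hv x).hasFDerivWithinAt) ((Psi_inj hK hv).injOn) Hf
  rw [Measure.restrict_univ] at hcv
  have h2 : ∫⁻ x in Psi K '' Set.univ, Hf x ≤ ∫⁻ x, Hf x := setLIntegral_le_lintegral _ _
  have hprod : ∫⁻ x, Hf x = (∫⁻ x : Eu n, ENNReal.ofReal (Real.exp (-phi K x))) *
      ∫⁻ y : Eu n, ENNReal.ofReal (Real.exp (-(infDist y K ^ 2 / 2))) := by
    rw [hH, Measure.volume_eq_prod]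
    refine lintegral_prod_mul (f := fun x => ENNReal.ofReal (Real.exp (-phi K x)))
      (g := fun y => ENNReal.ofReal (Real.exp (-(infDist y K ^ 2 / 2)))) ?_ ?_
    · have := phi_continuous hK hv
      have : Continuous fun x => Real.exp (-phi K x) := by fun_prop
      exact this.measurable.ennreal_ofReal.aemeasurable
    · have := continuous_infDist_pt K
      have : Continuous fun x => Real.exp (-(infDist x K ^ 2 / 2)) := by fun_prop
      exact this.measurable.ennreal_ofReal.aemeasurable
  rw [hcv, hprod] at h2
  have h3 : ENNReal.ofReal ((2 * π) ^ n) ≤ ENNReal.ofReal (2 ^ n) * ((∫⁻ x : Eu n, ENNReal.ofReal (Real.exp (-phi K x))) *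
      ∫⁻ y : Eu n, ENNReal.ofReal (Real.exp (-(infDist y K ^ 2 / 2)))) := by
    refine h1.trans (le_trans ?_ (mul_le_mul_right h2 _))
    rw [← lintegral_const_mul' _ _ ENNReal.ofReal_ne_top]
    refine lintegral_mono fun x => ?_
    rw [← Psi_det, hH]
    beta_reduce
    rw [← ENNReal.ofReal_mul (by positivity), ← ENNReal.ofReal_mul (by positivity),
      ← ENNReal.ofReal_mul (by positivity), ← Real.exp_add]
    refine ENNReal.ofReal_le_ofReal ?_
    have := Psi_exp hK hc hv hs x.1 x.2
    rw [mul_comm, mul_comm (|_|), mul_assoc]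
    gcongr
    linarith
  rw [mul_pow, ENNReal.ofReal_mul (by positivity)] at h3
  exact (ENNReal.mul_le_mul_iff_right (by positivity) ENNReal.ofReal_ne_top).1 h3

end RBM

namespace RBM

variable {n : ℕ} {K : Set (Eu n)}

theorem sqrt_pos_of (hn : 1 ≤ n) : 0 < √(n : ℝ) := by
  have : (0 : ℝ) < n := by exact_mod_cast hn
  positivity

theorem nhds_of_ball (hn : 1 ≤ n) (hb : closedBall (0 : Eu n) (√n) ⊆ K) : K ∈ nhds (0 : Eu n) :=
  Filter.mem_of_superset (closedBall_mem_nhds _ (sqrt_pos_of hn)) hb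

theorem vol_pos_of_ball (hn : 1 ≤ n) (hb : closedBall (0 : Eu n) (√n) ⊆ K) : 0 < volume K :=
  MeasureTheory.Measure.measure_pos_of_mem_nhds volume (nhds_of_ball hn hb)

theorem lintegral_gauge (hn : 1 ≤ n) (hK : IsCompact K) (hc : Convex ℝ K) (hs : -K = K)
    (hb : closedBall (0 : Eu n) (√n) ⊆ K) :
    ∫⁻ y : Eu n, ENNReal.ofReal (Real.exp (-(n * gauge K y))) ≤ volume K := by
  have hn0 : (0 : ℝ) < n := by exact_mod_cast hn
  have hnh := nhds_of_ball hn hb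
  have hab : Absorbent ℝ K := absorbent_nhds_zero hnh
  have hsym : ∀ x ∈ K, -x ∈ K := fun x hx => hs.subset (Set.neg_mem_neg.2 hx)
  have hcont : Continuous (gauge K) := continuous_gauge hc hnh
  have h0 : (0 : Eu n) ∈ K := mem_of_mem_nhds hnh
  have hsm : ∀ (r : ℝ) x, gauge K (r • x) = |r| * gauge K x := by
    intro r x
    rcases le_total 0 r with h | h
    · rw [gauge_smul_of_nonneg h, abs_of_nonneg h, smul_eq_mul]
    · have : r • x = -((-r) • x) := by simp
      rw [this, gauge_neg hsym, gauge_smul_of_nonneg (by linarith), abs_of_nonpos h, smul_eq_mul]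
  have key := measure_lt_one_eq_integral_div_gamma (volume : Measure (Eu n))
    (g := fun x => n * gauge K x) (by simp) (fun x => by simp [gauge_neg hsym])
    (fun x y => by
      have := gauge_add_le hc hab x y
      nlinarith)
    (fun {x} hx => by
      have : gauge K x = 0 := by
        rcases mul_eq_zero.1 hx with h | h
        · exact absurd h hn0.ne'
        · exact h
      exact (gauge_eq_zero hab (NormedSpace.isVonNBounded_of_isBounded ℝ hK.isBounded)).1 this)
    (fun r x => by
      rw [hsm]; apply le_of_eq; ring) one_pos
  simp only [Real.rpow_one, div_one, finrank_euclideanSpace, Fintype.card_fin] at key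
  set I := ∫ x : Eu n, Real.exp (-(n * gauge K x)) with hI
  have hpos : 0 < volume {x : Eu n | n * gauge K x < 1} := by
    refine IsOpen.measure_pos _ (isOpen_lt (by fun_prop) continuous_const) ⟨0, by simp⟩
  have hG : 0 < Real.Gamma (n + 1) := Real.Gamma_pos_of_pos (by positivity)
  have hIpos : I ≠ 0 := by
    intro h
    rw [key, h] at hpos
    simp at hpos
  have hint : Integrable fun x : Eu n => Real.exp (-(n * gauge K x)) := by
    by_contra h
    exact hIpos (integral_undef h)
  rw [← ofReal_integral_eq_lintegral_ofReal hint (Filter.Eventually.of_forall fun x => by positivity), ← hI]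
  have h1 : ENNReal.ofReal I = ENNReal.ofReal (Real.Gamma (n + 1)) * volume {x : Eu n | n * gauge K x < 1} := by
    rw [key, ← ENNReal.ofReal_mul hG.le]
    congr 1
    field_simp
  have h2 : {x : Eu n | n * gauge K x < 1} ⊆ (n : ℝ)⁻¹ • K := by
    intro x hx
    rw [Set.mem_inv_smul_set_iff₀ hn0.ne']
    apply setOfPred_gauge_lt_one_subset_self hc h0 hab
    change gauge K ((n : ℝ) • x) < 1
    rw [hsm, abs_of_pos hn0]
    exact hx
  rw [h1]
  refine (mul_le_mul_right (measure_mono h2) _).trans ?_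
  rw [Measure.addHaar_smul, ← mul_assoc, ← ENNReal.ofReal_mul hG.le]
  refine mul_le_of_le_one_left zero_le ?_
  rw [ENNReal.ofReal_le_one, finrank_euclideanSpace, Fintype.card_fin, abs_of_pos (by positivity), Real.Gamma_nat_eq_factorial]
  rw [inv_pow, ← div_eq_mul_inv, div_le_one (by positivity)]
  exact_mod_cast Nat.factorial_le_pow n

theorem gauss_le_gauge (hn : 1 ≤ n) (hK : IsCompact K) (hc : Convex ℝ K)
    (hb : closedBall (0 : Eu n) (√n) ⊆ K) (y : Eu n) :
    Real.exp (-(infDist y K ^ 2 / 2)) ≤ Real.exp (3 * n / 2) * Real.exp (-(n * gauge K y)) := by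
  have hq := sqrt_pos_of hn
  have hnh := nhds_of_ball hn hb
  have hab : Absorbent ℝ K := absorbent_nhds_zero hnh
  obtain ⟨z, hz, hd⟩ := hK.exists_infDist_eq_dist ⟨0, mem_of_mem_nhds hnh⟩ y
  rw [← Real.exp_add, Real.exp_le_exp, hd, dist_eq_norm]
  have h1 := gauge_add_le hc hab z (y - z)
  rw [add_sub_cancel] at h1
  have h2 := gauge_le_one_of_mem hz
  have h3 : √n * gauge K (y - z) ≤ ‖y - z‖ := mul_gauge_le_norm (ball_subset_closedBall.trans hb)
  have h4 : (√n) ^ 2 = (n : ℝ) := Real.sq_sqrt (Nat.cast_nonneg n)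
  rw [← h4]
  have h5 : (√n)^2 * gauge K y ≤ (√n)^2 * (1 + gauge K (y - z)) := by gcongr; linarith
  have h6 : (√n)^2 * gauge K (y-z) ≤ √n * ‖y - z‖ := by nlinarith
  nlinarith [sq_nonneg (√n - ‖y - z‖)]

theorem lintegral_gauss_le (hn : 1 ≤ n) (hK : IsCompact K) (hc : Convex ℝ K) (hs : -K = K)
    (hb : closedBall (0 : Eu n) (√n) ⊆ K) :
    ∫⁻ y : Eu n, ENNReal.ofReal (Real.exp (-(infDist y K ^ 2 / 2))) ≤
      ENNReal.ofReal (Real.exp (3 * n / 2)) * volume K := by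
  refine le_trans ?_ (mul_le_mul_right (lintegral_gauge hn hK hc hs hb) _)
  rw [← lintegral_const_mul' _ _ ENNReal.ofReal_ne_top]
  refine lintegral_mono fun y => ?_
  rw [← ENNReal.ofReal_mul (by positivity)]
  exact ENNReal.ofReal_le_ofReal (gauss_le_gauge hn hK hc hb y)

end RBM

namespace RBM

variable {n : ℕ} {K : Set (Eu n)}

theorem phi_two (hK : IsCompact K) (hv : 0 < volume K) (x : Eu n) :
    2 * phi K x ≤ phi K ((2 : ℝ) • x) := by
  have h := lam_mid hK hv ((2 : ℝ) • x) 0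
  rw [lam_zero, add_zero, smul_smul] at h
  norm_num at h
  unfold phi
  rw [norm_smul, mul_pow]
  norm_num
  nlinarith [sq_nonneg ‖x‖]

theorem integrable_gauss1 (b : ℝ) (hb : 0 < b) :
    Integrable (fun x : Eu n => Real.exp (-b * ‖x‖ ^ 2)) := by
  by_contra h
  have h1 := GaussianFourier.integral_rexp_neg_mul_sq_norm (V := Eu n) hb
  rw [integral_undef h] at h1
  have : 0 < (π / b) ^ (Module.finrank ℝ (Eu n) / 2 : ℝ) := by positivity
  linarith

theorem Z_lt_top (hK : IsCompact K) (hv : 0 < volume K) (hs : -K = K) :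
    ∫⁻ x : Eu n, ENNReal.ofReal (Real.exp (-phi K x)) < ⊤ := by
  have h := (integrable_gauss1 (n := n) (1 / 2) (by norm_num)).lintegral_lt_top
  refine lt_of_le_of_lt (lintegral_mono fun x => ENNReal.ofReal_le_ofReal ?_) h
  rw [Real.exp_le_exp]
  have := lam_nonneg hK hv hs x
  unfold phi
  linarith

theorem lintegral_phi_half (hK : IsCompact K) (hv : 0 < volume K) :
    ∫⁻ x : Eu n, ENNReal.ofReal (Real.exp (-(phi K x / 2))) ≤
      ENNReal.ofReal (2 ^ n) * ∫⁻ x : Eu n, ENNReal.ofReal (Real.exp (-phi K x)) := by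
  have hc := phi_continuous hK hv
  have h1 := Measure.map_addHaar_smul (volume : Measure (Eu n)) (r := (2 : ℝ)) two_ne_zero
  have h2 : ∫⁻ x, ENNReal.ofReal (Real.exp (-(phi K x / 2))) ∂(Measure.map ((2 : ℝ) • ·) (volume : Measure (Eu n))) =
    ∫⁻ x : Eu n, ENNReal.ofReal (Real.exp (-(phi K ((2 : ℝ) • x) / 2))) := by
    refine lintegral_map ?_ (by fun_prop)
    have : Continuous fun x => Real.exp (-(phi K x / 2)) := by fun_prop
    exact this.measurable.ennreal_ofReal
  rw [h1, lintegral_smul_measure] at h2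
  simp only [finrank_euclideanSpace, Fintype.card_fin, smul_eq_mul] at h2
  have h3 : ENNReal.ofReal (2 ^ n) * ENNReal.ofReal |((2 : ℝ) ^ n)⁻¹| = 1 := by
    rw [← ENNReal.ofReal_mul (by positivity), abs_of_pos (by positivity), mul_inv_cancel₀ (by positivity),
      ENNReal.ofReal_one]
  rw [← one_mul (∫⁻ x : Eu n, ENNReal.ofReal (Real.exp (-(phi K x / 2)))), ← h3, mul_assoc, h2]
  refine mul_le_mul_right (lintegral_mono fun x => ENNReal.ofReal_le_ofReal ?_) _
  rw [Real.exp_le_exp]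
  linarith [phi_two hK hv x]

/-- the good set -/
def SS (K : Set (Eu n)) : Set (Eu n) := {x | phi K x ≤ 4 * n}

theorem SS_meas (hK : IsCompact K) (hv : 0 < volume K) : MeasurableSet (SS K) :=
  (isClosed_le (phi_continuous hK hv) continuous_const).measurableSet

theorem exp_two_ge (hn : 1 ≤ n) : 2 * (Real.exp (-(2 * n)) * 2 ^ n) ≤ 1 := by
  have h1 : (4 : ℝ) ≤ Real.exp 2 := by
    have := Real.add_one_le_exp (1 : ℝ)
    have h2 : Real.exp 2 = Real.exp 1 * Real.exp 1 := by rw [← Real.exp_add]; norm_num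
    nlinarith
  have h2 : (2 : ℝ) ≤ 2 ^ n := by
    calc (2 : ℝ) = 2 ^ 1 := by norm_num
      _ ≤ 2 ^ n := pow_le_pow_right₀ (by norm_num) hn
  have h3 : Real.exp (2 * n) = Real.exp 2 ^ n := by rw [← Real.exp_nat_mul]; ring_nf
  have h4 : (4 : ℝ) ^ n ≤ Real.exp 2 ^ n := by gcongr
  have h5 : (4 : ℝ) ^ n = 2 ^ n * 2 ^ n := by rw [← mul_pow]; norm_num
  rw [Real.exp_neg, h3, ← mul_assoc, mul_comm 2 _, mul_assoc, inv_mul_le_iff₀ (by positivity)]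
  nlinarith

theorem Z_le (hn : 1 ≤ n) (hK : IsCompact K) (hv : 0 < volume K) (hs : -K = K) :
    ∫⁻ x : Eu n, ENNReal.ofReal (Real.exp (-phi K x)) ≤ 2 * volume (SS K) := by
  have hm := SS_meas hK hv
  have hZ := Z_lt_top hK hv hs
  set Z := ∫⁻ x : Eu n, ENNReal.ofReal (Real.exp (-phi K x)) with hZd
  have h0 : Z = (∫⁻ x in SS K, ENNReal.ofReal (Real.exp (-phi K x))) +
      ∫⁻ x in (SS K)ᶜ, ENNReal.ofReal (Real.exp (-phi K x)) := (lintegral_add_compl _ hm).symm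
  have h1 : ∫⁻ x in SS K, ENNReal.ofReal (Real.exp (-phi K x)) ≤ volume (SS K) := by
    rw [← setLIntegral_one]
    refine lintegral_mono fun x => ?_
    rw [ENNReal.ofReal_le_one, Real.exp_le_one_iff]
    have := lam_nonneg hK hv hs x
    have := sq_nonneg ‖x‖
    unfold phi
    linarith
  have h2 : 2 * ∫⁻ x in (SS K)ᶜ, ENNReal.ofReal (Real.exp (-phi K x)) ≤ Z := by
    have h3 : ∫⁻ x in (SS K)ᶜ, ENNReal.ofReal (Real.exp (-phi K x)) ≤
        ENNReal.ofReal (Real.exp (-(2 * n))) * ∫⁻ x : Eu n, ENNReal.ofReal (Real.exp (-(phi K x / 2))) := by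
      rw [← lintegral_const_mul' _ _ ENNReal.ofReal_ne_top]
      refine le_trans ?_ (setLIntegral_le_lintegral (SS K)ᶜ _)
      refine setLIntegral_mono' hm.compl fun x hx => ?_
      rw [← ENNReal.ofReal_mul (by positivity), ← Real.exp_add]
      refine ENNReal.ofReal_le_ofReal (Real.exp_le_exp.2 ?_)
      have : ¬ (phi K x ≤ 4 * n) := hx
      linarith
    calc 2 * ∫⁻ x in (SS K)ᶜ, ENNReal.ofReal (Real.exp (-phi K x))
        ≤ ENNReal.ofReal 2 * (ENNReal.ofReal (Real.exp (-(2 * n))) * (ENNReal.ofReal (2 ^ n) * Z)) := by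
          have e2 : ENNReal.ofReal 2 = 2 := by simp
          rw [e2]
          refine mul_le_mul_right (h3.trans (mul_le_mul_right (lintegral_phi_half hK hv) _)) _
      _ = ENNReal.ofReal (2 * (Real.exp (-(2 * n)) * 2 ^ n)) * Z := by
          rw [ENNReal.ofReal_mul (by norm_num), ENNReal.ofReal_mul (by positivity)]; ring
      _ ≤ 1 * Z := by
          gcongr
          rw [ENNReal.ofReal_le_one]
          exact exp_two_ge hn
      _ = Z := one_mul _
  have h4 : Z + Z ≤ 2 * volume (SS K) + Z := by
    calc Z + Z = 2 * Z := (two_mul Z).symm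
      _ = 2 * (∫⁻ x in SS K, ENNReal.ofReal (Real.exp (-phi K x))) +
      2 * ∫⁻ x in (SS K)ᶜ, ENNReal.ofReal (Real.exp (-phi K x)) := by rw [← mul_add, ← h0]
      _ ≤ _ := by gcongr
  exact (ENNReal.add_le_add_iff_right hZ.ne).1 h4

theorem FF_inj (hK : IsCompact K) (hv : 0 < volume K) : Function.Injective fun x => x + gg K x := by
  intro s t h
  have e1 := gg_mono hK hv s t
  have e2 : gg K s - gg K t = -(s - t) := by
    have h' : s + gg K s = t + gg K t := h
    have : gg K s = t + gg K t - s := by rw [← h']; abel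
    rw [this]; abel
  rw [e2, inner_neg_right, real_inner_self_eq_norm_sq] at e1
  have e4 : ‖s - t‖ = 0 := by nlinarith [norm_nonneg (s - t)]
  rwa [norm_eq_zero, sub_eq_zero] at e4

theorem SS_norm (hK : IsCompact K) (hv : 0 < volume K) (hs : -K = K) {x : Eu n} (hx : x ∈ SS K) :
    ‖x‖ ≤ 3 * √n ∧ lam K x ≤ 4 * n := by
  have h1 : phi K x ≤ 4 * n := hx
  have h2 := lam_nonneg hK hv hs x
  unfold phi at h1
  constructor
  · refine abs_le_of_sq_le_sq' ?_ (by positivity) |>.2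
    rw [mul_pow, Real.sq_sqrt (Nat.cast_nonneg n)]
    have : (0 : ℝ) ≤ n := Nat.cast_nonneg n
    linarith
  · nlinarith [sq_nonneg ‖x‖]

theorem exists_good (hn : 1 ≤ n) (hK : IsCompact K) (hc : Convex ℝ K) (hs : -K = K)
    (hb : closedBall (0 : Eu n) (√n) ⊆ K) :
    ∃ x : Eu n, lam K x ≤ 4 * n ∧
      |(ContinuousLinearMap.id ℝ (Eu n) + gg' K x).det| ≤ 16 ^ n * (volume K).toReal ^ 2 := by
  have hv := vol_pos_of_ball hn hb
  have hvt : volume K ≠ ⊤ := hK.measure_ne_top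
  have hm := SS_meas hK hv
  set D : Eu n → ENNReal := fun x => ENNReal.ofReal |(ContinuousLinearMap.id ℝ (Eu n) + gg' K x).det| with hD
  have hcv : ∫⁻ x in SS K, D x = volume ((fun x => x + gg K x) '' SS K) :=
    lintegral_abs_det_fderiv_eq_addHaar_image volume hm
      (fun x _ => ((hasFDerivAt_id x).add (gg_hasFDerivAt hK hv x)).hasFDerivWithinAt)
      (FF_inj hK hv).injOn
  have hsub : (fun x => x + gg K x) '' SS K ⊆ (4 : ℝ) • K := by
    rintro _ ⟨x, hx, rfl⟩
    have h1 := (SS_norm hK hv hs hx).1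
    have : (4 : ℝ) • K = (3 : ℝ) • K + (1 : ℝ) • K := by
      rw [← hc.add_smul (by norm_num) (by norm_num)]; norm_num
    rw [this, one_smul]
    refine Set.add_mem_add ?_ (gg_mem hK hc hv x)
    rw [Set.mem_smul_set_iff_inv_smul_mem₀ (by norm_num)]
    apply hb
    rw [mem_closedBall_zero_iff, norm_smul]
    norm_num
    linarith
  have hI : ∫⁻ x in SS K, D x ≤ ENNReal.ofReal (4 ^ n) * volume K := by
    rw [hcv]
    refine (measure_mono hsub).trans ?_
    rw [Measure.addHaar_smul, finrank_euclideanSpace, Fintype.card_fin, abs_of_pos (by positivity)]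
  have hlow : ENNReal.ofReal (π ^ n) ≤ 2 * volume (SS K) * (ENNReal.ofReal (Real.exp (3 * n / 2)) * volume K) :=
    (rsantalo hK hc hv hs).trans (mul_le_mul' (Z_le hn hK hv hs) (lintegral_gauss_le hn hK hc hs hb))
  have hS0 : volume (SS K) ≠ 0 := by
    intro h
    rw [h] at hlow
    simp only [mul_zero, zero_mul, nonpos_iff_eq_zero, ENNReal.ofReal_eq_zero] at hlow
    have : 0 < π ^ n := by positivity
    linarith
  have hSt : volume (SS K) ≠ ⊤ := by
    refine ne_top_of_le_ne_top (measure_closedBall_lt_top (x := (0 : Eu n)) (r := 3 * √n)).ne (measure_mono fun x hx => ?_)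
    rw [mem_closedBall_zero_iff]
    exact (SS_norm hK hv hs hx).1
  have hDm : AEMeasurable D (volume.restrict (SS K)) := by
    have : Continuous fun x => |(ContinuousLinearMap.id ℝ (Eu n) + gg' K x).det| :=
      (ContinuousLinearMap.continuous_det.comp (continuous_const.add (gg'_continuous hK hv))).abs
    exact this.measurable.ennreal_ofReal.aemeasurable
  obtain ⟨x, hx, hle⟩ := exists_le_setLAverage hS0 hSt hDm
  refine ⟨x, (SS_norm hK hv hs hx).2, ?_⟩
  rw [setLAverage_eq, ENNReal.le_div_iff_mul_le (Or.inl hS0) (Or.inl hSt)] at hle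
  have h5 := hle.trans hI
  -- to reals
  set V := (volume K).toReal with hV
  set S := (volume (SS K)).toReal with hS
  have hVe : volume K = ENNReal.ofReal V := (ENNReal.ofReal_toReal hvt).symm
  have hSe : volume (SS K) = ENNReal.ofReal S := (ENNReal.ofReal_toReal hSt).symm
  have hV0 : 0 ≤ V := ENNReal.toReal_nonneg
  have hS0' : 0 ≤ S := ENNReal.toReal_nonneg
  have e2 : (2 : ENNReal) = ENNReal.ofReal 2 := by simp
  rw [hVe, hSe, e2, ← ENNReal.ofReal_mul (by positivity), ← ENNReal.ofReal_mul (by positivity),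
    ← ENNReal.ofReal_mul (by positivity), ENNReal.ofReal_le_ofReal_iff (by positivity)] at hlow
  rw [hVe, hSe, hD, ← ENNReal.ofReal_mul (by positivity), ← ENNReal.ofReal_mul (by positivity),
    ENNReal.ofReal_le_ofReal_iff (by positivity)] at h5
  set d := |(ContinuousLinearMap.id ℝ (Eu n) + gg' K x).det| with hd
  have hd0 : 0 ≤ d := abs_nonneg _
  have hE : Real.exp (3 * n / 2) ≤ 6 ^ n := by
    have : Real.exp (3 * n / 2) = Real.exp (3 / 2) ^ n := by rw [← Real.exp_nat_mul]; ring_nf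
    rw [this]
    have h1 : Real.exp (3 / 2) ≤ 6 := by
      have h1 : Real.exp (3 / 2) ≤ Real.exp 1 * Real.exp 1 := by
        rw [← Real.exp_add, Real.exp_le_exp]; norm_num
      have h2 := Real.exp_one_lt_d9
      have h3 := Real.exp_pos 1
      have h4 : Real.exp (3/2) ^ 2 = Real.exp 1 ^ 3 := by
        rw [← Real.exp_nat_mul, ← Real.exp_nat_mul]; norm_num
      have h5 : Real.exp 1 ^ 3 ≤ 3 ^ 3 := by gcongr; linarith
      nlinarith [Real.exp_pos (3/2)]
    gcongr
  have h2n : (2 : ℝ) ≤ 2 ^ n := by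
    calc (2 : ℝ) = 2 ^ 1 := by norm_num
      _ ≤ 2 ^ n := pow_le_pow_right₀ (by norm_num) hn
  have hp : (3 : ℝ) ^ n ≤ π ^ n := by gcongr; exact pi_gt_three.le
  have h6 : d * 3 ^ n ≤ 3 ^ n * (16 ^ n * V ^ 2) := by
    calc d * 3 ^ n ≤ d * π ^ n := by gcongr
      _ ≤ d * (2 * S * (Real.exp (3 * n / 2) * V)) := by gcongr
      _ = (d * S) * (2 * Real.exp (3 * n / 2) * V) := by ring
      _ ≤ (4 ^ n * V) * (2 ^ n * 6 ^ n * V) := by gcongr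
      _ = (4 * 2 * 6) ^ n * V ^ 2 := by rw [mul_pow, mul_pow]; ring
      _ = (3 * 16) ^ n * V ^ 2 := by norm_num
      _ = _ := by rw [mul_pow]; ring
  rw [mul_comm] at h6
  exact le_of_mul_le_mul_left h6 (by positivity)

end RBM

namespace RBM

variable {n : ℕ} {K : Set (Eu n)}

theorem mm_half (hK : IsCompact K) (hc : Convex ℝ K) (x : Eu n) {y0 : Eu n} (hy : y0 ∈ K) :
    (1 / 2) ^ n * Real.exp (inner ℝ x y0 / 2) * mm K ((1 / 2 : ℝ) • x) ≤ mm K x := by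
  have hder : ∀ y ∈ K, HasFDerivWithinAt (fun y : Eu n => (1 / 2 : ℝ) • (y + y0))
      ((1 / 2 : ℝ) • ContinuousLinearMap.id ℝ (Eu n)) K y := fun y _ =>
    (((hasFDerivAt_id y).add_const y0).const_smul (1 / 2 : ℝ)).hasFDerivWithinAt
  have hinj : Set.InjOn (fun y : Eu n => (1 / 2 : ℝ) • (y + y0)) K := by
    intro a _ b _ h
    have := smul_right_injective (Eu n) (by norm_num : (1 / 2 : ℝ) ≠ 0) h
    exact add_right_cancel this
  have h1 := integral_image_eq_integral_abs_det_fderiv_smul volume hK.measurableSet hder hinj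
    (fun z => Real.exp (inner ℝ x z))
  have hsub : (fun y : Eu n => (1 / 2 : ℝ) • (y + y0)) '' K ⊆ K := by
    rintro _ ⟨y, hy', rfl⟩
    have := hc hy' hy (a := 1 / 2) (b := 1 / 2) (by norm_num) (by norm_num) (by norm_num)
    rwa [← smul_add] at this
  have h2 : ∫ z in (fun y : Eu n => (1 / 2 : ℝ) • (y + y0)) '' K, Real.exp (inner ℝ x z) ≤ mm K x := by
    rw [mm_eq]
    exact setIntegral_mono_set (mm_integrable hK x)
      (Filter.Eventually.of_forall fun y => (Real.exp_pos _).le) (Filter.Eventually.of_forall hsub)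
  refine le_trans (le_of_eq ?_) h2
  rw [h1, mm_eq, ← integral_const_mul]
  refine integral_congr_ae (Filter.Eventually.of_forall fun y => ?_)
  have hdet : ((1 / 2 : ℝ) • ContinuousLinearMap.id ℝ (Eu n)).det = (1 / 2) ^ n := by
    rw [← det_mat, mat_smul, mat_id, Matrix.det_smul]
    simp
  simp only [hdet, smul_eq_mul]
  rw [abs_of_pos (by positivity), mul_assoc, ← Real.exp_add]
  congr 2
  rw [inner_smul_left, inner_smul_right, inner_add_right]
  simp
  ring

theorem mm_zero : mm K 0 = (volume K).toReal := by
  rw [mm_eq]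
  simp [Measure.real]

theorem mm_lam (hK : IsCompact K) (hv : 0 < volume K) (x : Eu n) :
    mm K x = Real.exp (lam K x) * (volume K).toReal := by
  have h0 := mm_pos hK hv 0
  unfold lam
  rw [Real.exp_sub, Real.exp_log (mm_pos hK hv x), Real.exp_log h0, ← mm_zero]
  field_simp

theorem density_le (hK : IsCompact K) (hc : Convex ℝ K) (hv : 0 < volume K) (hs : -K = K) {x : Eu n}
    (hx : lam K x ≤ 4 * n) {y : Eu n} (hy : y ∈ K) :
    Real.exp (inner ℝ x y) * (volume K).toReal ≤ 400 ^ n * mm K x := by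
  have h1 := mm_half hK hc x hy
  rw [mm_lam hK hv, mm_lam hK hv x] at h1
  have hV : 0 < (volume K).toReal := by rw [← mm_zero]; exact mm_pos hK hv 0
  set V := (volume K).toReal
  rw [← mul_assoc, mul_le_mul_iff_left₀ hV] at h1
  have h2 : 1 ≤ Real.exp (lam K ((1 / 2 : ℝ) • x)) := Real.one_le_exp (lam_nonneg hK hv hs _)
  have h3 : (1 / 2) ^ n * Real.exp (inner ℝ x y / 2) ≤ Real.exp (lam K x) :=
    le_trans (le_mul_of_one_le_right (by positivity) h2) h1
  have h4 : Real.exp (inner ℝ x y / 2) ≤ 2 ^ n * Real.exp (lam K x) := by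
    have e : (1 / 2 : ℝ) ^ n = (2 ^ n)⁻¹ := by rw [one_div, inv_pow]
    rwa [e, inv_mul_le_iff₀ (by positivity)] at h3
  have h5 : Real.exp (inner ℝ x y) = Real.exp (inner ℝ x y / 2) ^ 2 := by
    rw [← Real.exp_nat_mul]; congr 1; push_cast; ring
  have h6 : Real.exp (lam K x) ≤ 100 ^ n := by
    calc Real.exp (lam K x) ≤ Real.exp (4 * n) := Real.exp_le_exp.2 hx
      _ = (Real.exp 1 ^ 4) ^ n := by rw [← Real.exp_nat_mul, ← Real.exp_nat_mul]; congr 1; push_cast; ring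
      _ ≤ (3 ^ 4) ^ n := by
        gcongr
        linarith [Real.exp_one_lt_d9]
      _ ≤ 100 ^ n := by gcongr; norm_num
  rw [mm_lam hK hv x, ← mul_assoc]
  gcongr
  calc Real.exp (inner ℝ x y) ≤ (2 ^ n * Real.exp (lam K x)) ^ 2 := by rw [h5]; gcongr
    _ = 4 ^ n * Real.exp (lam K x) * Real.exp (lam K x) := by
      rw [show (4 : ℝ) = 2 ^ 2 by norm_num, ← pow_mul, mul_comm 2 n, pow_mul]; ring
    _ ≤ 4 ^ n * 100 ^ n * Real.exp (lam K x) := by gcongr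
    _ = 400 ^ n * Real.exp (lam K x) := by rw [← mul_pow]; norm_num

theorem exists_ellipsoid (hn : 1 ≤ n) (hK : IsCompact K) (hc : Convex ℝ K) (hs : -K = K)
    (hb : closedBall (0 : Eu n) (√n) ⊆ K) :
    ∃ (S : Eu n →ₗ[ℝ] Eu n) (g : Eu n), 0 < LinearMap.det S ∧
      LinearMap.det S ≤ 4 ^ n * (volume K).toReal ∧
      (volume K).toReal ≤ 800 ^ n *
        (volume (K ∩ (fun w => g + S w) '' closedBall 0 (√(2 * n)))).toReal := by
  have hv := vol_pos_of_ball hn hb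
  have hn0 : (0 : ℝ) < n := by exact_mod_cast hn
  obtain ⟨x, hlam, hdet⟩ := exists_good hn hK hc hs hb
  set Q : Eu n →ₗ[ℝ] Eu n := ((ContinuousLinearMap.id ℝ (Eu n) + gg' K x : Eu n →L[ℝ] Eu n) : Eu n →ₗ[ℝ] Eu n) with hQ
  have hQa : ∀ u, Q u = u + gg' K x u := fun u => rfl
  have hsym : Q.IsSymmetric := by
    intro u w
    rw [hQa, hQa, inner_add_left, inner_add_right, real_inner_comm, gg'_symm hK,
      real_inner_comm w (gg' K x u)]
  have hfr : Module.finrank ℝ (Eu n) = n := by simp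
  set b := hsym.eigenvectorBasis hfr with hbdef
  set μ := hsym.eigenvalues hfr with hμ
  have hap : ∀ i, Q (b i) = μ i • b i := fun i => hsym.apply_eigenvectorBasis hfr i
  have hb1 : ∀ i, inner ℝ (b i) (b i) = (1 : ℝ) := fun i => by
    rw [real_inner_self_eq_norm_sq, b.orthonormal.1 i]; norm_num
  have hcov : ∀ i, inner ℝ (b i) (gg' K x (b i)) = μ i - 1 := by
    intro i
    have h1 : gg' K x (b i) = μ i • b i - b i := by rw [← hap i, hQa]; abel
    rw [h1, inner_sub_right, inner_smul_right, hb1]; ring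
  have hμ1 : ∀ i, 1 ≤ μ i := by
    intro i
    have h1 := gg'_var hK hv x (b i)
    have h2 : 0 ≤ mm K x * inner ℝ (b i) (gg' K x (b i)) := by
      rw [h1]; exact integral_nonneg fun y => by positivity
    rw [hcov] at h2
    have := nonneg_of_mul_nonneg_right h2 (mm_pos hK hv x)
    linarith
  have hμ0 : ∀ i, 0 < μ i := fun i => lt_of_lt_of_le one_pos (hμ1 i)
  have hdetQ : LinearMap.det Q = ∏ i, μ i := by
    have := hsym.det_eq_prod_eigenvalues hfr
    simpa using this
  set S : Eu n →ₗ[ℝ] Eu n := Matrix.toLin b.toBasis b.toBasis (Matrix.diagonal fun i => √(μ i)) with hS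
  have hSdet : LinearMap.det S = ∏ i, √(μ i) := by
    rw [hS, LinearMap.det_toLin, Matrix.det_diagonal]
  have hSpos : 0 < LinearMap.det S := by
    rw [hSdet]; exact Finset.prod_pos fun i _ => Real.sqrt_pos.2 (hμ0 i)
  have hSb : ∀ i, S (b i) = √(μ i) • b i := by
    intro i
    have := Matrix.toLin_self b.toBasis b.toBasis (Matrix.diagonal fun i => √(μ i)) i
    rw [OrthonormalBasis.coe_toBasis] at this
    rw [hS, this]
    rw [Finset.sum_eq_single i]
    · simp
    · intro j _ hj; simp [Matrix.diagonal_apply_ne _ hj]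
    · simp
  refine ⟨S, gg K x, hSpos, ?_, ?_⟩
  · have h1 : (LinearMap.det S) ^ 2 = LinearMap.det Q := by
      rw [hSdet, hdetQ, ← Finset.prod_pow]
      exact Finset.prod_congr rfl fun i _ => Real.sq_sqrt (hμ0 i).le
    have h2 : (LinearMap.det S) ^ 2 ≤ (4 ^ n * (volume K).toReal) ^ 2 := by
      rw [h1, mul_pow, ← pow_mul, mul_comm n 2, pow_mul]
      norm_num
      exact (le_abs_self _).trans hdet
    exact (abs_le_of_sq_le_sq' h2 (by positivity)).2
  · set g := gg K x with hg
    set E := (fun w => g + S w) '' closedBall 0 (√(2 * n)) with hE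
    set q : Eu n → ℝ := fun y => ∑ i, (inner ℝ (b i) (y - g)) ^ 2 / μ i with hq
    have hqE : ∀ y, q y ≤ 2 * n → y ∈ E := by
      intro y hy
      refine ⟨∑ i, (inner ℝ (b i) (y - g) / √(μ i)) • b i, ?_, ?_⟩
      · rw [mem_closedBall_zero_iff]
        refine Real.le_sqrt_of_sq_le ?_
        rw [← real_inner_self_eq_norm_sq, b.orthonormal.inner_sum]
        refine le_trans (le_of_eq ?_) hy
        refine Finset.sum_congr rfl fun i _ => ?_
        simp only [conj_trivial]
        rw [← sq, div_pow, Real.sq_sqrt (hμ0 i).le]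
      · simp only [map_sum, map_smul, hSb, smul_smul]
        have : ∀ i, inner ℝ (b i) (y - g) / √(μ i) * √(μ i) = inner ℝ (b i) (y - g) := fun i =>
          div_mul_cancel₀ _ (Real.sqrt_pos.2 (hμ0 i)).ne'
        simp only [this]
        rw [b.sum_repr' (y - g)]
        abel
    have hEc : IsCompact E := by
      refine (isCompact_closedBall _ _).image ?_
      have : Continuous S := S.continuous_of_finiteDimensional
      fun_prop
    set A := K ∩ E with hA
    have hAc : IsCompact A := hK.inter hEc
    set m := mm K x with hm
    have hm0 : 0 < m := mm_pos hK hv x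
    set V := (volume K).toReal with hV
    have hV0 : 0 < V := by rw [hV, ← mm_zero]; exact mm_pos hK hv 0
    have hint : ∀ i, IntegrableOn (fun y => Real.exp (inner ℝ x y) * (inner ℝ (b i) (y - g)) ^ 2) K := by
      intro i
      have : Continuous (fun y => Real.exp (inner ℝ x y) * (inner ℝ (b i) (y - g)) ^ 2) := by fun_prop
      exact this.continuousOn.integrableOn_compact hK
    have hintq : IntegrableOn (fun y => Real.exp (inner ℝ x y) * q y) K := by
      have : Continuous (fun y => Real.exp (inner ℝ x y) * q y) := by rw [hq]; fun_prop
      exact this.continuousOn.integrableOn_compact hK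
    have hqint : ∫ y in K, Real.exp (inner ℝ x y) * q y ≤ n * m := by
      have e1 : ∫ y in K, Real.exp (inner ℝ x y) * q y =
          ∑ i, ∫ y in K, (Real.exp (inner ℝ x y) * (inner ℝ (b i) (y - g)) ^ 2) / μ i := by
        rw [← integral_finsetSum]
        · refine integral_congr_ae (Filter.Eventually.of_forall fun y => ?_)
          simp only [hq, Finset.mul_sum, mul_div_assoc]
        · intro i _
          exact (hint i).div_const _
      rw [e1]
      have e2 : ∀ i, ∫ y in K, (Real.exp (inner ℝ x y) * (inner ℝ (b i) (y - g)) ^ 2) / μ i ≤ m := by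
        intro i
        rw [integral_div, ← gg'_var hK hv x (b i), hcov, div_le_iff₀ (hμ0 i)]
        gcongr
        linarith
      calc _ ≤ ∑ i : Fin n, m := Finset.sum_le_sum fun i _ => e2 i
        _ = n * m := by simp
    have hAi : IntegrableOn (A.indicator fun _ => 400 ^ n * m / V) K := by
      refine Integrable.indicator ?_ hAc.measurableSet
      exact integrableOn_const hK.measure_ne_top
    have hAint : ∫ y in K, A.indicator (fun _ => 400 ^ n * m / V) y = (volume A).toReal * (400 ^ n * m / V) := by
      rw [setIntegral_indicator hAc.measurableSet, setIntegral_const, hA, ← Set.inter_assoc, Set.inter_self]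
      rfl
    have hmain : m ≤ (volume A).toReal * (400 ^ n * m / V) + (n * m) / (2 * n) := by
      calc m = ∫ y in K, Real.exp (inner ℝ x y) := mm_eq x
        _ ≤ ∫ y in K, (A.indicator (fun _ => 400 ^ n * m / V) y + Real.exp (inner ℝ x y) * q y / (2 * n)) := by
          refine setIntegral_mono_on (mm_integrable hK x) (hAi.add (hintq.div_const _)) hK.measurableSet fun y hy => ?_
          have hq0 : 0 ≤ q y := Finset.sum_nonneg fun i _ => div_nonneg (sq_nonneg _) (hμ0 i).le
          by_cases h : y ∈ A
          · rw [Set.indicator_of_mem h]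
            have h1 := density_le hK hc hv hs hlam hy
            have h2 : Real.exp (inner ℝ x y) ≤ 400 ^ n * m / V := by rwa [le_div_iff₀ hV0]
            have h3 : 0 ≤ Real.exp (inner ℝ x y) * q y / (2 * n) := by positivity
            linarith
          · rw [Set.indicator_of_notMem h, zero_add]
            have h1 : 2 * n < q y := by
              by_contra h2
              exact h ⟨hy, hqE y (not_lt.1 h2)⟩
            rw [le_div_iff₀ (by positivity)]
            gcongr
        _ = (volume A).toReal * (400 ^ n * m / V) + (∫ y in K, Real.exp (inner ℝ x y) * q y) / (2 * n) := by
          rw [integral_add hAi (hintq.div_const _), hAint, integral_div]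
        _ ≤ _ := by gcongr
    have h1 : n * m / (2 * n) = m / 2 := by field_simp
    rw [h1] at hmain
    have h2 : V ≤ 2 * 400 ^ n * (volume A).toReal := by
      have h3 : m / 2 ≤ (volume A).toReal * (400 ^ n * m / V) := by linarith
      have h4 : (volume A).toReal * (400 ^ n * m / V) = m * ((volume A).toReal * 400 ^ n / V) := by ring
      rw [h4, div_eq_mul_one_div, mul_le_mul_iff_right₀ hm0, le_div_iff₀ hV0] at h3
      linarith
    have h2n : (2 : ℝ) ≤ 2 ^ n := by
      calc (2 : ℝ) = 2 ^ 1 := by norm_num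
        _ ≤ 2 ^ n := pow_le_pow_right₀ (by norm_num) hn
    calc V ≤ 2 * 400 ^ n * (volume A).toReal := h2
      _ ≤ 2 ^ n * 400 ^ n * (volume A).toReal := by gcongr
      _ = _ := by rw [← mul_pow]; norm_num

end RBM

namespace RBM

variable {n : ℕ} {K L : Set (Eu n)}

theorem cpt_sub {A B : Set (Eu n)} (hA : IsCompact A) (hB : IsCompact B) : IsCompact (A - B) := by
  rw [sub_eq_add_neg]; exact hA.add hB.neg

theorem ruzsa {A X Y : Set (Eu n)} (hA : IsCompact A) (hX : IsCompact X) (hY : IsCompact Y) :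
    volume A * volume (X + Y) ≤ volume (X + A) * volume (Y - A) := by
  have hP := (hX.add hA).measurableSet
  have hQ := (cpt_sub hY hA).measurableSet
  set P := X + A with hPd
  set Q := Y - A with hQd
  have hmeas : Measurable fun zw : Eu n × Eu n =>
      P.indicator (fun _ => (1 : ENNReal)) zw.2 * Q.indicator (fun _ => (1 : ENNReal)) (zw.1 - zw.2) := by
    refine Measurable.mul ?_ ?_
    · exact (measurable_const.indicator hP).comp measurable_snd
    · exact (measurable_const.indicator hQ).comp (measurable_fst.sub measurable_snd)
  have hswap := lintegral_lintegral_swap (μ := (volume : Measure (Eu n))) (ν := (volume : Measure (Eu n)))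
    (f := fun z w => P.indicator (fun _ => (1 : ENNReal)) w * Q.indicator (fun _ => (1 : ENNReal)) (z - w))
    hmeas.aemeasurable
  have hr : ∫⁻ w : Eu n, ∫⁻ z : Eu n, P.indicator (fun _ => (1 : ENNReal)) w *
      Q.indicator (fun _ => (1 : ENNReal)) (z - w) = volume P * volume Q := by
    have : ∀ w : Eu n, ∫⁻ z : Eu n, P.indicator (fun _ => (1 : ENNReal)) w *
      Q.indicator (fun _ => (1 : ENNReal)) (z - w) = P.indicator (fun _ => (1 : ENNReal)) w * volume Q := by
      intro w
      have hq : Measurable fun z => Q.indicator (fun _ => (1 : ENNReal)) (z - w) :=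
        (measurable_const.indicator hQ).comp (measurable_id.sub_const w)
      rw [lintegral_const_mul _ hq,
        lintegral_sub_right_eq_self (fun z => Q.indicator (fun _ => (1 : ENNReal)) z) w,
        lintegral_indicator_const hQ, one_mul]
    simp_rw [this]
    rw [lintegral_mul_const _ (measurable_const.indicator hP), lintegral_indicator_const hP, one_mul]
  rw [hr] at hswap
  rw [← hswap]
  have hXY := (hX.add hY).measurableSet
  rw [← lintegral_indicator_const hXY]
  refine lintegral_mono fun z => ?_
  by_cases hz : z ∈ X + Y
  · rw [Set.indicator_of_mem hz]
    obtain ⟨x, hx, y, hy, rfl⟩ := hz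
    have hAx : MeasurableSet ((fun a => x + a) '' A) := (hA.image (continuous_const.add continuous_id)).measurableSet
    have h1 : volume A = ∫⁻ w : Eu n, ((fun a => x + a) '' A).indicator (fun _ => (1 : ENNReal)) w := by
      rw [lintegral_indicator_const hAx, one_mul, Set.image_add_left, measure_preimage_add]
    rw [h1]
    refine lintegral_mono fun w => ?_
    by_cases hw : w ∈ (fun a => x + a) '' A
    · obtain ⟨a, ha, rfl⟩ := hw
      have e1 : x + a ∈ P := Set.add_mem_add hx ha
      have e2 : x + y - (x + a) ∈ Q := by
        have : x + y - (x + a) = y - a := by abel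
        rw [this]; exact Set.sub_mem_sub hy ha
      simp only [Set.indicator_of_mem e1, Set.indicator_of_mem e2]
      rw [mul_one]
      exact Set.indicator_le_self' (fun _ _ => zero_le) _
    · rw [Set.indicator_of_notMem hw]; exact zero_le
  · rw [Set.indicator_of_notMem hz]; exact zero_le

theorem ruzsaR {A X Y : Set (Eu n)} (hA : IsCompact A) (hX : IsCompact X) (hY : IsCompact Y) :
    (volume A).toReal * (volume (X + Y)).toReal ≤ (volume (X + A)).toReal * (volume (Y - A)).toReal := by
  rw [← ENNReal.toReal_mul, ← ENNReal.toReal_mul]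
  exact ENNReal.toReal_mono (ENNReal.mul_ne_top (hX.add hA).measure_ne_top (cpt_sub hY hA).measure_ne_top)
    (ruzsa hA hX hY)

theorem volR_mono {A B : Set (Eu n)} (h : A ⊆ B) (hB : IsCompact B) :
    (volume A).toReal ≤ (volume B).toReal :=
  ENNReal.toReal_mono hB.measure_ne_top (measure_mono h)

theorem volR_smul (r : ℝ) (hr : 0 ≤ r) (A : Set (Eu n)) :
    (volume (r • A)).toReal = r ^ n * (volume A).toReal := by
  rw [Measure.addHaar_smul, finrank_euclideanSpace, Fintype.card_fin, abs_of_nonneg (by positivity),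
    ENNReal.toReal_mul, ENNReal.toReal_ofReal (by positivity)]

theorem volR_image (T : Eu n →ₗ[ℝ] Eu n) (A : Set (Eu n)) :
    (volume (T '' A)).toReal = |LinearMap.det T| * (volume A).toReal := by
  rw [Measure.addHaar_image_linearMap, ENNReal.toReal_mul, ENNReal.toReal_ofReal (abs_nonneg _)]

theorem volR_neg (A : Set (Eu n)) : (volume (-A)).toReal = (volume A).toReal := by
  rw [Measure.measure_neg]

theorem self_add (hc : Convex ℝ K) : K + K = (2 : ℝ) • K := by
  have := hc.add_smul (p := 1) (q := 1) (by norm_num) (by norm_num)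
  rw [one_smul] at this
  rw [← this]; norm_num

/-- weak Rogers-Shephard -/
theorem diff_body (hK : IsCompact K) (hc : Convex ℝ K) (h : 0 < (volume K).toReal) :
    (volume (K - K)).toReal ≤ 4 ^ n * (volume K).toReal := by
  have h1 := ruzsaR hK hK hK.neg
  have e : -K - K = -((2 : ℝ) • K) := by rw [← self_add hc, neg_add, ← sub_eq_add_neg]
  rw [e, volR_neg, self_add hc, volR_smul _ (by norm_num), ← sub_eq_add_neg] at h1
  have h2 : (2 : ℝ) ^ n * (volume K).toReal * (2 ^ n * (volume K).toReal) =
      (volume K).toReal * (4 ^ n * (volume K).toReal) := by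
    rw [show (4 : ℝ) = 2 * 2 by norm_num, mul_pow]; ring
  rw [h2] at h1
  exact le_of_mul_le_mul_left h1 h

theorem ball_vol : (volume (closedBall (0 : Eu n) (√(2 * n)))).toReal ≤ 9 ^ n := by
  have hint := integrable_gauss1 (n := n) (1 / 2) (by norm_num)
  have hb : MeasurableSet (closedBall (0 : Eu n) (√(2 * n))) := measurableSet_closedBall
  have h1 : (volume (closedBall (0 : Eu n) (√(2 * n)))).toReal =
      ∫ x : Eu n, (closedBall (0 : Eu n) (√(2 * n))).indicator (fun _ => (1 : ℝ)) x := by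
    rw [integral_indicator_const _ hb]; simp [Measure.real]
  have h2 : ∫ x : Eu n, (closedBall (0 : Eu n) (√(2 * n))).indicator (fun _ => (1 : ℝ)) x ≤
      ∫ x : Eu n, Real.exp n * Real.exp (-(1 / 2) * ‖x‖ ^ 2) := by
    refine integral_mono ?_ (hint.const_mul _) fun x => ?_
    · refine (integrable_indicator_iff hb).2 (integrableOn_const ?_)
      exact (isCompact_closedBall _ _).measure_ne_top
    · by_cases hx : x ∈ closedBall (0 : Eu n) (√(2 * n))
      · rw [Set.indicator_of_mem hx]
        beta_reduce
        rw [← Real.exp_add]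
        refine Real.one_le_exp ?_
        rw [mem_closedBall_zero_iff] at hx
        have h3 : ‖x‖ ^ 2 ≤ (√(2 * n)) ^ 2 := by gcongr
        rw [Real.sq_sqrt (by positivity)] at h3
        linarith
      · rw [Set.indicator_of_notMem hx]; positivity
  rw [h1]
  refine h2.trans ?_
  rw [integral_const_mul, GaussianFourier.integral_rexp_neg_mul_sq_norm (by norm_num), finrank_euclideanSpace,
    Fintype.card_fin]
  have e1 : (π / (1 / 2)) ^ ((n : ℝ) / 2) ≤ 3 ^ n := by
    have : (3 : ℝ) ^ n = (3 ^ 2 : ℝ) ^ ((n : ℝ) / 2) := by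
      rw [← Real.rpow_natCast, ← Real.rpow_natCast, ← Real.rpow_mul (by norm_num)]
      congr 1; push_cast; ring
    rw [this]
    refine Real.rpow_le_rpow (by positivity) ?_ (by positivity)
    linarith [Real.pi_lt_d2]
  have e2 : Real.exp n ≤ 3 ^ n := by
    rw [← Real.exp_one_pow]
    gcongr
    linarith [Real.exp_one_lt_d9]
  calc _ ≤ (3 : ℝ) ^ n * 3 ^ n := by gcongr
    _ = 9 ^ n := by rw [← mul_pow]; norm_num

theorem sym_case (hn : 1 ≤ n) (hK : IsCompact K) (hKc : Convex ℝ K) (hKs : -K = K)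
    (hKb : closedBall (0 : Eu n) (√n) ⊆ K)
    (hL : IsCompact L) (hLc : Convex ℝ L) (hLs : -L = L) (hLb : closedBall (0 : Eu n) (√n) ⊆ L) :
    ∃ T : Eu n →ₗ[ℝ] Eu n, LinearMap.det T = 1 ∧ (volume (K + T '' L)).toReal ≤
      (10 ^ 8 * ((volume K).toReal ^ ((1 : ℝ) / n) + (volume L).toReal ^ ((1 : ℝ) / n))) ^ n := by
  have hn0 : (n : ℝ) ≠ 0 := by have : n ≠ 0 := by omega
                               exact_mod_cast this
  obtain ⟨S, g, hS0, hSd, hSv⟩ := exists_ellipsoid hn hK hKc hKs hKb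
  obtain ⟨S', g', hS0', hSd', hSv'⟩ := exists_ellipsoid hn hL hLc hLs hLb
  have hVK : 0 < (volume K).toReal := ENNReal.toReal_pos (vol_pos_of_ball hn hKb).ne' hK.measure_ne_top
  have hVL : 0 < (volume L).toReal := ENNReal.toReal_pos (vol_pos_of_ball hn hLb).ne' hL.measure_ne_top
  set B := closedBall (0 : Eu n) (√(2 * n)) with hB
  have hBc : IsCompact B := isCompact_closedBall _ _
  have hBx : Convex ℝ B := convex_closedBall _ _
  have hScont : Continuous S := S.continuous_of_finiteDimensional
  have hScont' : Continuous S' := S'.continuous_of_finiteDimensional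
  set E := (fun w => g + S w) '' B with hE
  set E' := (fun w => g' + S' w) '' B with hE'
  have hEc : IsCompact E := hBc.image (by fun_prop)
  have hEc' : IsCompact E' := hBc.image (by fun_prop)
  set d := LinearMap.det S with hd
  set d' := LinearMap.det S' with hd'
  set s := d ^ ((1 : ℝ) / n) with hs
  set s' := d' ^ ((1 : ℝ) / n) with hs'
  have hrn : ∀ a : ℝ, 0 ≤ a → (a ^ ((1 : ℝ) / n)) ^ n = a := by
    intro a ha
    rw [one_div, Real.rpow_inv_natCast_pow ha (by omega)]
  have hsn : s ^ n = d := hrn d hS0.le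
  have hsn' : s' ^ n = d' := hrn d' hS0'.le
  have hs0 : 0 < s := Real.rpow_pos_of_pos hS0 _
  have hs0' : 0 < s' := Real.rpow_pos_of_pos hS0' _
  set l := s' / s with hl
  have hl0 : 0 < l := by positivity
  set e := LinearEquiv.ofIsUnitDet (f := S') (v := (EuclideanSpace.basisFun (Fin n) ℝ).toBasis)
    (v' := (EuclideanSpace.basisFun (Fin n) ℝ).toBasis)
    (by rw [LinearMap.det_toMatrix]; exact hS0'.ne'.isUnit) with he
  have hea : ∀ w, e w = S' w := fun w => rfl
  set T : Eu n →ₗ[ℝ] Eu n := l • (S ∘ₗ (e.symm : Eu n →ₗ[ℝ] Eu n)) with hT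
  have hTS : ∀ w, T (S' w) = l • S w := by
    intro w
    rw [← hea, hT]
    simp
  have hTdet : LinearMap.det T = 1 := by
    have h1 : T ∘ₗ S' = l • S := LinearMap.ext hTS
    have h2 := congrArg LinearMap.det h1
    rw [LinearMap.det_comp, LinearMap.det_smul l S, finrank_euclideanSpace, Fintype.card_fin, ← hd, ← hd', hl, div_pow,
      hsn, hsn', div_mul_cancel₀ _ hS0.ne'] at h2
    exact mul_right_cancel₀ hS0'.ne' (h2.trans (one_mul _).symm)
  have hTcont : Continuous T := T.continuous_of_finiteDimensional
  refine ⟨T, hTdet, ?_⟩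
  have hTL : IsCompact (T '' L) := hL.image hTcont
  set A := K ∩ E with hA
  set A' := L ∩ E' with hA'
  have hAc : IsCompact A := hK.inter hEc
  have hAc' : IsCompact A' := hL.inter hEc'
  have hTA : IsCompact (T '' A') := hAc'.image hTcont
  have r1 := ruzsaR hAc hK hTL
  have r2 := ruzsaR hTA hTL hEc.neg
  rw [volR_image, hTdet, abs_one, one_mul] at r2
  have i1 : (volume (K + A)).toReal ≤ 2 ^ n * (volume K).toReal := by
    rw [← volR_smul 2 (by norm_num), ← self_add hKc]
    exact volR_mono (Set.add_subset_add_left Set.inter_subset_left) (hK.add hK)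
  have i2 : (volume (T '' L - A)).toReal ≤ (volume (T '' L + -E)).toReal := by
    rw [← sub_eq_add_neg]
    exact volR_mono (Set.sub_subset_sub_left Set.inter_subset_right) (cpt_sub hTL hEc)
  have i3 : (volume (T '' L + T '' A')).toReal ≤ 2 ^ n * (volume L).toReal := by
    have h1 : (volume (T '' (L + L))).toReal = 2 ^ n * (volume L).toReal := by
      rw [volR_image, hTdet, self_add hLc, volR_smul 2 (by norm_num), abs_one, one_mul]
    rw [← h1]
    refine volR_mono ?_ ((hL.add hL).image hTcont)
    rw [← Set.image_add]
    exact Set.image_mono (Set.add_subset_add_left Set.inter_subset_left)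
  have i4 : (volume (-E - T '' A')).toReal ≤ (s + s') ^ n * (volume B).toReal := by
    have hsub : -E - T '' A' ⊆ (fun w => (-g - T g') + w) '' (S '' ((1 + l) • B)) := by
      rintro _ ⟨a, ha, b, ⟨c, hc, rfl⟩, rfl⟩
      obtain ⟨w, hw, hwa⟩ := Set.mem_neg.1 ha
      obtain ⟨w', hw', hwc⟩ := hc.2
      refine ⟨S (-w - l • w'), ⟨-w - l • w', ?_, rfl⟩, ?_⟩
      · rw [hBx.add_smul (by norm_num) hl0.le, one_smul, sub_eq_add_neg]
        refine Set.add_mem_add ?_ ⟨-w', ?_, by simp⟩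
        · simpa [hB] using hw
        · simpa [hB] using hw'
      · have ha' : a = -(g + S w) := by rw [← neg_neg a, ← hwa]
        rw [ha', ← hwc]
        simp only [map_sub, map_neg, map_add, map_smul, hTS]
        abel
    have hc' : IsCompact (S '' ((1 + l) • B)) := (hBc.smul _).image hScont
    refine (volR_mono hsub (hc'.image (by fun_prop))).trans (le_of_eq ?_)
    rw [Set.image_add_left, measure_preimage_add, volR_image, volR_smul _ (by positivity), ← hd, abs_of_pos hS0, ← hsn,
      ← mul_assoc, ← mul_pow, mul_add, mul_one, hl, mul_div_cancel₀ _ hs0.ne']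
  have hA0 : 0 < (volume A).toReal := pos_of_mul_pos_right (hVK.trans_le hSv) (by positivity)
  have hA0' : 0 < (volume A').toReal := pos_of_mul_pos_right (hVL.trans_le hSv') (by positivity)
  set k := (volume K).toReal with hk
  set m := (volume L).toReal with hm
  set a := (volume A).toReal with ha
  set a' := (volume A').toReal with ha'
  set F := (volume (T '' L + -E)).toReal with hF
  set G := (volume (K + T '' L)).toReal with hG
  have hF0 : 0 ≤ F := ENNReal.toReal_nonneg
  have j1 : G ≤ 1600 ^ n * F := by
    have : a * G ≤ a * (1600 ^ n * F) := by
      calc a * G ≤ (2 ^ n * k) * F := r1.trans (mul_le_mul i1 i2 ENNReal.toReal_nonneg (by positivity))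
        _ ≤ (2 ^ n * (800 ^ n * a)) * F := by gcongr
        _ = (2 * 800) ^ n * a * F := by rw [mul_pow]; ring
        _ = a * (1600 ^ n * F) := by norm_num; ring
    exact le_of_mul_le_mul_left this hA0
  have j2 : F ≤ 1600 ^ n * ((s + s') ^ n * (volume B).toReal) := by
    have : a' * F ≤ a' * (1600 ^ n * ((s + s') ^ n * (volume B).toReal)) := by
      calc a' * F ≤ (2 ^ n * m) * ((s + s') ^ n * (volume B).toReal) :=
            r2.trans (mul_le_mul i3 i4 ENNReal.toReal_nonneg (by positivity))
        _ ≤ (2 ^ n * (800 ^ n * a')) * ((s + s') ^ n * (volume B).toReal) := by gcongr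
        _ = (2 * 800) ^ n * a' * ((s + s') ^ n * (volume B).toReal) := by rw [mul_pow]; ring
        _ = _ := by norm_num; ring
    exact le_of_mul_le_mul_left this hA0'
  have hsk : s ≤ 4 * k ^ ((1 : ℝ) / n) := by
    refine le_of_pow_le_pow_left₀ (n := n) (by omega) (by positivity) ?_
    rw [hsn, mul_pow, hrn k hVK.le]
    exact hSd
  have hsm : s' ≤ 4 * m ^ ((1 : ℝ) / n) := by
    refine le_of_pow_le_pow_left₀ (n := n) (by omega) (by positivity) ?_
    rw [hsn', mul_pow, hrn m hVL.le]
    exact hSd'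
  set p := k ^ ((1 : ℝ) / n) with hp
  set r := m ^ ((1 : ℝ) / n) with hr
  have hp0 : 0 ≤ p := by positivity
  have hr0 : 0 ≤ r := by positivity
  have := ball_vol (n := n)
  calc G ≤ 1600 ^ n * (1600 ^ n * ((s + s') ^ n * 9 ^ n)) := by
        refine j1.trans ?_
        gcongr
        refine j2.trans ?_
        gcongr
    _ ≤ 1600 ^ n * (1600 ^ n * ((4 * p + 4 * r) ^ n * 9 ^ n)) := by gcongr
    _ = (1600 * (1600 * ((4 * p + 4 * r) * 9))) ^ n := by simp only [mul_pow]
    _ ≤ (10 ^ 8 * (p + r)) ^ n := by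
      refine pow_le_pow_left₀ (by positivity) ?_ n
      linarith

end RBM

namespace RBM

variable {n : ℕ} {K L : Set (Eu n)}

theorem wills_upper (hn : 1 ≤ n) {M P : Set (Eu n)} (hM : IsCompact M) (hM0 : M.Nonempty) (c : Eu n)
    (hP : IsCompact P) (hPc : Convex ℝ P) (hPs : -P = P) (hPb : closedBall (0 : Eu n) (√n) ⊆ P)
    (hMP : ∀ m ∈ M, m - c ∈ P) :
    Integrable (fun x : Eu n => Real.exp (-π * (infDist x M) ^ 2)) ∧
      wills M ≤ 6 ^ n * (volume P).toReal := by
  have hle : ∀ x : Eu n, Real.exp (-π * (infDist x M) ^ 2) ≤ Real.exp (-(infDist (x - c) P ^ 2 / 2)) := by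
    intro x
    obtain ⟨m, hm, hd⟩ := hM.exists_infDist_eq_dist hM0 x
    have h1 : infDist (x - c) P ≤ infDist x M := by
      rw [hd, ← dist_sub_right x m c]
      exact infDist_le_dist_of_mem (hMP m hm)
    have h2 : infDist (x - c) P ^ 2 ≤ infDist x M ^ 2 := by
      gcongr; exact infDist_nonneg
    rw [Real.exp_le_exp]
    nlinarith [Real.pi_gt_three, sq_nonneg (infDist x M)]
  have hI : ∫⁻ x : Eu n, ENNReal.ofReal (Real.exp (-π * (infDist x M) ^ 2)) ≤
      ENNReal.ofReal (Real.exp (3 * n / 2)) * volume P := by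
    refine le_trans (lintegral_mono fun x => ENNReal.ofReal_le_ofReal (hle x)) ?_
    rw [lintegral_sub_right_eq_self (fun x => ENNReal.ofReal (Real.exp (-(infDist x P ^ 2 / 2)))) c]
    exact lintegral_gauss_le hn hP hPc hPs hPb
  have hcont : Continuous fun x : Eu n => Real.exp (-π * (infDist x M) ^ 2) := by
    have := continuous_infDist_pt M
    fun_prop
  have hft : ENNReal.ofReal (Real.exp (3 * n / 2)) * volume P ≠ ⊤ :=
    ENNReal.mul_ne_top ENNReal.ofReal_ne_top hP.measure_ne_top
  have hint : Integrable (fun x : Eu n => Real.exp (-π * (infDist x M) ^ 2)) := by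
    refine ⟨hcont.aestronglyMeasurable, ?_⟩
    rw [hasFiniteIntegral_iff_ofReal (Filter.Eventually.of_forall fun x => (Real.exp_pos _).le)]
    exact lt_of_le_of_lt hI hft.lt_top
  refine ⟨hint, ?_⟩
  unfold wills
  rw [integral_eq_lintegral_of_nonneg_ae (Filter.Eventually.of_forall fun x => (Real.exp_pos _).le)
    hcont.aestronglyMeasurable]
  refine (ENNReal.toReal_mono hft hI).trans ?_
  rw [ENNReal.toReal_mul, ENNReal.toReal_ofReal (Real.exp_pos _).le]
  gcongr
  have : Real.exp (3 * n / 2) = Real.exp (3 / 2) ^ n := by rw [← Real.exp_nat_mul]; ring_nf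
  rw [this]
  have h1 : Real.exp (3 / 2) ≤ 6 := by
    have h2 := Real.exp_one_lt_d9
    have h3 := Real.exp_pos 1
    have h4 : Real.exp (3/2) ^ 2 = Real.exp 1 ^ 3 := by
      rw [← Real.exp_nat_mul, ← Real.exp_nat_mul]; norm_num
    have h5 : Real.exp 1 ^ 3 ≤ 3 ^ 3 := by gcongr; linarith
    nlinarith [Real.exp_pos (3/2)]
  gcongr

/-- symmetrised and fattened body -/
def fat (K : Set (Eu n)) : Set (Eu n) := (K - K) + closedBall (0 : Eu n) (√n)

theorem fat_compact (hK : IsCompact K) : IsCompact (fat K) :=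
  (cpt_sub hK hK).add (isCompact_closedBall _ _)

theorem fat_convex (hc : Convex ℝ K) : Convex ℝ (fat K) :=
  (hc.sub hc).add (convex_closedBall _ _)

theorem fat_symm : -fat K = fat K := by
  unfold fat
  rw [neg_add, neg_sub, neg_closedBall, neg_zero]

theorem fat_ball (h0 : K.Nonempty) : closedBall (0 : Eu n) (√n) ⊆ fat K := by
  obtain ⟨k, hk⟩ := h0
  intro x hx
  exact ⟨k - k, Set.sub_mem_sub hk hk, x, hx, by simp⟩

theorem sub_fat {a b : Eu n} (ha : a ∈ K) (hb : b ∈ K) : a - b ∈ fat K :=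
  ⟨a - b, Set.sub_mem_sub ha hb, 0, by simp, by simp⟩

theorem fat_vol (hn : 1 ≤ n) (hK : IsCompact K) (hc : Convex ℝ K) (h0 : K.Nonempty) :
    (volume (fat K)).toReal ≤ 12 ^ n * wills K := by
  obtain ⟨k0, hk0⟩ := id h0
  have hq := sqrt_pos_of hn
  obtain ⟨hint, -⟩ := wills_upper hn hK h0 k0 (fat_compact hK) (fat_convex hc) fat_symm (fat_ball h0)
    (fun m hm => sub_fat hm hk0)
  set K1 := K + closedBall (0 : Eu n) (√n / 2) with hK1
  have hK1c : IsCompact K1 := hK.add (isCompact_closedBall _ _)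
  have hK1x : Convex ℝ K1 := hc.add (convex_closedBall _ _)
  have hpos : 0 < (volume K1).toReal := by
    refine ENNReal.toReal_pos (ne_of_gt ?_) hK1c.measure_ne_top
    refine lt_of_lt_of_le (measure_closedBall_pos volume k0 (half_pos hq)) (measure_mono fun x hx => ?_)
    refine ⟨k0, hk0, x - k0, ?_, by simp⟩
    rwa [mem_closedBall_zero_iff, ← dist_eq_norm]
  have hsub : fat K ⊆ K1 - K1 := by
    rintro _ ⟨_, ⟨a, ha, b, hb, rfl⟩, u, hu, rfl⟩
    rw [mem_closedBall_zero_iff] at hu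
    have hu2 : (1 / 2 : ℝ) • u ∈ closedBall (0 : Eu n) (√n / 2) := by
      rw [mem_closedBall_zero_iff, norm_smul]
      norm_num
      linarith
    have hu3 : -((1 / 2 : ℝ) • u) ∈ closedBall (0 : Eu n) (√n / 2) := by
      rw [mem_closedBall_zero_iff, norm_neg]
      rwa [mem_closedBall_zero_iff] at hu2
    refine ⟨a + (1 / 2 : ℝ) • u, Set.add_mem_add ha hu2, b + -((1 / 2 : ℝ) • u), Set.add_mem_add hb hu3, ?_⟩
    module
  have h1 : (volume (fat K)).toReal ≤ 4 ^ n * (volume K1).toReal :=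
    (volR_mono hsub (cpt_sub hK1c hK1c)).trans (diff_body hK1c hK1x hpos)
  have h2 : (volume K1).toReal ≤ 3 ^ n * wills K := by
    have e1 : (volume K1).toReal = ∫ x : Eu n, K1.indicator (fun _ => (1 : ℝ)) x := by
      rw [integral_indicator_const _ hK1c.measurableSet]; simp [Measure.real]
    rw [e1, wills, ← integral_const_mul]
    refine integral_mono ?_ (hint.const_mul _) fun x => ?_
    · exact (integrable_indicator_iff hK1c.measurableSet).2 (integrableOn_const hK1c.measure_ne_top)
    · by_cases hx : x ∈ K1
      · rw [Set.indicator_of_mem hx]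
        beta_reduce
        obtain ⟨a, ha, u, hu, rfl⟩ := hx
        rw [mem_closedBall_zero_iff] at hu
        have h3 : infDist (a + u) K ≤ √n / 2 := by
          refine (infDist_le_dist_of_mem ha).trans ?_
          simpa [dist_eq_norm] using hu
        have h4 : infDist (a + u) K ^ 2 ≤ (√n / 2) ^ 2 := by
          gcongr; exact infDist_nonneg
        rw [div_pow, Real.sq_sqrt (Nat.cast_nonneg n)] at h4
        have h5 : Real.exp n ≤ 3 ^ n := by
          rw [← Real.exp_one_pow]
          gcongr
          linarith [Real.exp_one_lt_d9]
        calc (1 : ℝ) ≤ Real.exp (n + -π * infDist (a + u) K ^ 2) := by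
              refine Real.one_le_exp ?_
              have h6 : π * infDist (a + u) K ^ 2 ≤ 4 * (n / 2 ^ 2) := by
                refine mul_le_mul Real.pi_le_four h4 (sq_nonneg _) (by norm_num)
              linarith
          _ = Real.exp n * Real.exp (-π * infDist (a + u) K ^ 2) := Real.exp_add _ _
          _ ≤ _ := by gcongr
      · rw [Set.indicator_of_notMem hx]; positivity
  calc _ ≤ (4 : ℝ) ^ n * (volume K1).toReal := h1
    _ ≤ 4 ^ n * (3 ^ n * wills K) := by gcongr
    _ = _ := by rw [← mul_assoc, ← mul_pow]; norm_num

theorem wills_nonneg : 0 ≤ wills K := integral_nonneg fun _ => (Real.exp_pos _).le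

end RBM

/-- Reverse Brunn-Minkowski inequality for the Wills functional: there is
an absolute constant `C > 0` such that for every `n ≥ 1` and all convex bodies `K, L ⊆ ℝⁿ`
there is a volume-preserving linear map `T` (determinant `1`) with
`W(K + TL)^{1/n} ≤ C (W(K)^{1/n} + W(L)^{1/n})`. -/
theorem wills_reverse_brunn_minkowski :
    ∃ C : ℝ, 0 < C ∧ ∀ (n : ℕ), 1 ≤ n → ∀ K L : Set (EuclideanSpace ℝ (Fin n)),
      IsCompact K → Convex ℝ K → K.Nonempty →
      IsCompact L → Convex ℝ L → L.Nonempty →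
      ∃ T : EuclideanSpace ℝ (Fin n) →ₗ[ℝ] EuclideanSpace ℝ (Fin n),
        LinearMap.det T = 1 ∧
          wills (K + T '' L) ^ ((1 : ℝ) / n) ≤
            C * (wills K ^ ((1 : ℝ) / n) + wills L ^ ((1 : ℝ) / n)) := by
  refine ⟨10 ^ 10, by norm_num, fun n hn K L hK hKc hK0 hL hLc hL0 => ?_⟩
  obtain ⟨T, hT, hvol⟩ := RBM.sym_case hn (RBM.fat_compact hK) (RBM.fat_convex hKc) RBM.fat_symm (RBM.fat_ball hK0)
    (RBM.fat_compact hL) (RBM.fat_convex hLc) RBM.fat_symm (RBM.fat_ball hL0)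
  refine ⟨T, hT, ?_⟩
  have hTc : Continuous T := T.continuous_of_finiteDimensional
  obtain ⟨k0, hk0⟩ := id hK0
  obtain ⟨l0, hl0⟩ := id hL0
  have hn' : n ≠ 0 := by omega
  have hfL0 : (0 : EuclideanSpace ℝ (Fin n)) ∈ RBM.fat L := by
    have := RBM.sub_fat hl0 hl0
    rwa [sub_self] at this
  have hup := (RBM.wills_upper hn (M := K + T '' L) (P := RBM.fat K + T '' RBM.fat L)
    (hK.add (hL.image hTc)) (hK0.add (hL0.image _)) (k0 + T l0)
    ((RBM.fat_compact hK).add ((RBM.fat_compact hL).image hTc))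
    ((RBM.fat_convex hKc).add ((RBM.fat_convex hLc).linear_image T))
    (by
      have h1 : -(T '' RBM.fat L) = T '' RBM.fat L := by
        conv_rhs => rw [← RBM.fat_symm (K := L)]
        rw [Set.image_neg_of_apply_neg_eq_neg fun x _ => map_neg T x]
      rw [neg_add, h1, RBM.fat_symm])
    (fun x hx => ⟨x, RBM.fat_ball hK0 hx, 0, ⟨0, hfL0, map_zero T⟩, add_zero x⟩)
    (by
      rintro _ ⟨a, ha, _, ⟨b, hb, rfl⟩, rfl⟩
      refine ⟨a - k0, RBM.sub_fat ha hk0, T (b - l0), ⟨b - l0, RBM.sub_fat hb hl0, rfl⟩, ?_⟩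
      simp only [map_sub]
      abel)).2
  have hroot : ∀ M : Set (EuclideanSpace ℝ (Fin n)), IsCompact M → Convex ℝ M → M.Nonempty →
      (volume (RBM.fat M)).toReal ^ ((1 : ℝ) / n) ≤ 12 * wills M ^ ((1 : ℝ) / n) := by
    intro M h1 h2 h3
    refine (Real.rpow_le_rpow ENNReal.toReal_nonneg (RBM.fat_vol hn h1 h2 h3) (by positivity)).trans (le_of_eq ?_)
    rw [Real.mul_rpow (by positivity) RBM.wills_nonneg, one_div, Real.pow_rpow_inv_natCast (by norm_num) hn']
  have hKr := hroot K hK hKc hK0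
  have hLr := hroot L hL hLc hL0
  set p := wills K ^ ((1 : ℝ) / n) with hp
  set r := wills L ^ ((1 : ℝ) / n) with hr
  have hp0 : 0 ≤ p := Real.rpow_nonneg RBM.wills_nonneg _
  have hr0 : 0 ≤ r := Real.rpow_nonneg RBM.wills_nonneg _
  have hfin : wills (K + T '' L) ≤ (10 ^ 10 * (p + r)) ^ n := by
    calc wills (K + T '' L) ≤ 6 ^ n * (10 ^ 8 * ((volume (RBM.fat K)).toReal ^ ((1 : ℝ) / n)
          + (volume (RBM.fat L)).toReal ^ ((1 : ℝ) / n))) ^ n := hup.trans (by gcongr)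
      _ ≤ 6 ^ n * (10 ^ 8 * (12 * p + 12 * r)) ^ n := by gcongr
      _ = (6 * (10 ^ 8 * (12 * p + 12 * r))) ^ n := by rw [mul_pow 6]
      _ ≤ _ := by
        refine pow_le_pow_left₀ (by positivity) ?_ n
        linarith
  refine (Real.rpow_le_rpow RBM.wills_nonneg hfin (by positivity)).trans (le_of_eq ?_)
  rw [one_div, Real.pow_rpow_inv_natCast (by positivity) hn']
end

section
/- Let K, E ⊆ ℝⁿ be convex bodies with 0 ∈ int E and let u ∈ co(ℝ≥0). Then for any λ ∈ (0,1), W_u(K;E) ≥ (λ^{−λ}(1−λ)^{−(1−λ)})ⁿ · (∫_{ℝⁿ} e^{−u(|x|_E)/(1−λ)} dx)^{1−λ} · vol(K)^{λ}. In particular, taking E = B₂ⁿ the Euclidean unit ball and u(t) = πt², one has W(K) ≥ (λ^{−λ}(1−λ)^{−(1−λ)/2})ⁿ · vol(K)^{λ}. -/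
open scoped Pointwise
open MeasureTheory Metric Real

/-- The relative distance `d_E(x,K) = min {t ≥ 0 : x ∈ K + tE}`. -/
noncomputable def distE {V : Type*} [AddCommGroup V] [Module ℝ V] (E K : Set V) (x : V) : ℝ :=
  sInf {t : ℝ | 0 ≤ t ∧ x ∈ K + t • E}

/-- The generalized Wills functional `W_u(K;E) = ∫_{ℝⁿ} e^{-u(d_E(x,K))} dx`. -/
noncomputable def willsGen {n : ℕ} (u : ℝ → ℝ) (K E : Set (EuclideanSpace ℝ (Fin n))) : ℝ :=
  ∫ x, Real.exp (-u (distE E K x))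

theorem bm_compact {p q : ℝ} (hp : 0 < p) (hq : 0 < q) {A B C : Set ℝ}
    (hA : IsCompact A) (hB : IsCompact B) (hA' : A.Nonempty) (hB' : B.Nonempty)
    (h : ∀ a ∈ A, ∀ b ∈ B, p * a + q * b ∈ C) :
    ENNReal.ofReal p * volume A + ENNReal.ofReal q * volume B ≤ volume C := by
  obtain ⟨a, haA, ha⟩ := hA.exists_isGreatest hA'
  obtain ⟨b, hbB, hb⟩ := hB.exists_isLeast hB'
  have key : ∀ (r c : ℝ) (S : Set ℝ), 0 < r →
      volume ((fun x => c + x) '' (r • S)) = ENNReal.ofReal r * volume S := by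
    intro r c S hr
    rw [Set.image_add_left, measure_preimage_add, Measure.addHaar_smul]
    simp [abs_of_pos hr]
  rw [← key p (q * b) A hp, ← key q (p * a) B hq, ← measure_union₀]
  · apply measure_mono
    rintro x (⟨_, ⟨y, hy, rfl⟩, rfl⟩ | ⟨_, ⟨y, hy, rfl⟩, rfl⟩)
    · have := h y hy b hbB
      simpa [add_comm] using this
    · have := h a haA y hy
      simpa [add_comm] using this
  · exact (((hB.smul q).image (by fun_prop)).measurableSet).nullMeasurableSet
  · have : ((fun x => q * b + x) '' (p • A)) ∩ ((fun x => p * a + x) '' (q • B))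
        ⊆ {p * a + q * b} := by
      rintro x ⟨⟨_, ⟨y, hy, rfl⟩, rfl⟩, ⟨_, ⟨z, hz, rfl⟩, hxz⟩⟩
      have h1 := ha hy
      have h2 := hb hz
      simp only [smul_eq_mul, Set.mem_singleton_iff] at *
      nlinarith [mul_le_mul_of_nonneg_left h1 hp.le, mul_le_mul_of_nonneg_left h2 hq.le]
    exact measure_mono_null this (by simp)

theorem bm_real {p q : ℝ} (hp : 0 < p) (hq : 0 < q) {A B C : Set ℝ}
    (hA : MeasurableSet A) (hB : MeasurableSet B) (hA' : A.Nonempty) (hB' : B.Nonempty)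
    (h : ∀ a ∈ A, ∀ b ∈ B, p * a + q * b ∈ C) :
    ENNReal.ofReal p * volume A + ENNReal.ofReal q * volume B ≤ volume C := by
  obtain ⟨a, ha⟩ := hA'
  obtain ⟨b, hb⟩ := hB'
  rw [hA.measure_eq_iSup_isCompact, hB.measure_eq_iSup_isCompact]
  simp only [ENNReal.mul_iSup, iSup_and']
  refine ENNReal.biSup_add_biSup_le' ⟨∅, by simp⟩ ⟨∅, by simp⟩ ?_
  rintro K ⟨hK, hKc⟩ L ⟨hL, hLc⟩
  refine le_trans ?_ (bm_compact hp hq (A := insert a K) (B := insert b L) (C := C)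
    (hKc.insert a) (hLc.insert b) (by simp) (by simp) ?_)
  · gcongr <;> simp
  · intro x hx y hy
    exact h x (Set.insert_subset ha hK hx) y (Set.insert_subset hb hL hy)

theorem amgm {p q : ℝ} (hp : 0 < p) (hq : 0 < q) (hpq : p + q = 1) (x y : ENNReal) :
    x ^ p * y ^ q ≤ ENNReal.ofReal p * x + ENNReal.ofReal q * y := by
  have hc : (p⁻¹).HolderConjugate q⁻¹ := by
    rw [Real.holderConjugate_iff]
    refine ⟨?_, by simpa using hpq⟩
    rw [one_lt_inv₀ hp]; linarith
  have := ENNReal.young_inequality (x ^ p) (y ^ q) hc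
  rw [← ENNReal.rpow_mul, ← ENNReal.rpow_mul, mul_inv_cancel₀ hp.ne', mul_inv_cancel₀ hq.ne',
    ENNReal.rpow_one, ENNReal.rpow_one, ENNReal.ofReal_inv_of_pos hp,
    ENNReal.ofReal_inv_of_pos hq, div_eq_mul_inv, div_eq_mul_inv, inv_inv, inv_inv] at this
  rwa [mul_comm (ENNReal.ofReal p), mul_comm (ENNReal.ofReal q)]

theorem layer (f : ℝ → ENNReal) (hf : Measurable f) (hf1 : ∀ x, f x ≤ 1) :
    ∫⁻ x, f x = ∫⁻ t in Set.Ioo (0 : ℝ) 1, volume {x | ENNReal.ofReal t < f x} := by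
  have h1 : ∀ x, f x ≠ ⊤ := fun x => ne_top_of_le_ne_top ENNReal.one_ne_top (hf1 x)
  have := lintegral_eq_lintegral_meas_lt (f := fun x => (f x).toReal) volume
    (Filter.Eventually.of_forall fun x => ENNReal.toReal_nonneg) hf.ennreal_toReal.aemeasurable
  simp only [ENNReal.ofReal_toReal (h1 _)] at this
  rw [this, ← lintegral_indicator measurableSet_Ioi, ← lintegral_indicator measurableSet_Ioo]
  refine lintegral_congr fun t => ?_
  by_cases ht : 0 < t
  · by_cases ht1 : t < 1
    · rw [Set.indicator_of_mem (by exact ht), Set.indicator_of_mem (Set.mem_Ioo.2 ⟨ht, ht1⟩)]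
      congr 1
      ext x
      exact (ENNReal.ofReal_lt_iff_lt_toReal ht.le (h1 x)).symm
    · rw [Set.indicator_of_mem (by exact ht), Set.indicator_of_notMem (fun h => ht1 h.2)]
      have : {a | t < (f a).toReal} = ∅ := by
        ext x
        have : (f x).toReal ≤ 1 := ENNReal.toReal_mono ENNReal.one_ne_top (hf1 x)
        simp only [Set.mem_ofPred_eq, Set.mem_empty_iff_false, iff_false]
        linarith
      rw [this, measure_empty]
  · rw [Set.indicator_of_notMem (fun h => ht (Set.mem_Ioi.1 h)), Set.indicator_of_notMem (fun h => ht h.1)]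

theorem pl_norm {p q : ℝ} (hp : 0 < p) (hq : 0 < q) (hpq : p + q = 1) {f g h : ℝ → ENNReal}
    (hf : Measurable f) (hg : Measurable g) (hh : Measurable h)
    (hf1 : ⨆ x, f x = 1) (hg1 : ⨆ x, g x = 1)
    (H : ∀ x y, f x ^ p * g y ^ q ≤ h (p * x + q * y)) :
    (∫⁻ x, f x) ^ p * (∫⁻ x, g x) ^ q ≤ ∫⁻ x, h x := by
  refine (amgm hp hq hpq _ _).trans ?_
  have hfl : ∀ x, f x ≤ 1 := fun x => hf1 ▸ le_iSup f x
  have hgl : ∀ x, g x ≤ 1 := fun x => hg1 ▸ le_iSup g x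
  refine le_trans ?_ (lintegral_mono (fun x => min_le_left (h x) 1))
  rw [layer f hf hfl, layer g hg hgl, layer _ (hh.min measurable_const) (fun x => min_le_right _ _)]
  have mf : Measurable fun t : ℝ => volume {x | ENNReal.ofReal t < f x} := by
    apply Antitone.measurable
    intro s t hst
    exact measure_mono fun x hx => lt_of_le_of_lt (ENNReal.ofReal_le_ofReal hst) hx
  rw [← lintegral_const_mul' _ _ ENNReal.ofReal_ne_top, ← lintegral_const_mul' _ _ ENNReal.ofReal_ne_top,
    ← lintegral_add_left (mf.const_mul _)]
  refine setLIntegral_mono' measurableSet_Ioo fun t ht => ?_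
  have ht1 : ENNReal.ofReal t < 1 := by simpa using ht.2
  apply bm_real hp hq (measurableSet_lt measurable_const hf) (measurableSet_lt measurable_const hg)
  · rw [← hf1] at ht1
    exact lt_iSup_iff.1 ht1
  · rw [← hg1] at ht1
    exact lt_iSup_iff.1 ht1
  · intro a ha b hb
    simp only [Set.mem_ofPred_eq] at *
    refine lt_min (lt_of_lt_of_le ?_ (H a b)) ht1
    calc ENNReal.ofReal t = ENNReal.ofReal t ^ p * ENNReal.ofReal t ^ q := by
          rw [← ENNReal.rpow_add_of_nonneg _ _ hp.le hq.le, hpq, ENNReal.rpow_one]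
      _ < _ := ENNReal.mul_lt_mul (ENNReal.rpow_lt_rpow ha hp) (ENNReal.rpow_lt_rpow hb hq)

theorem pl_bdd {p q : ℝ} (hp : 0 < p) (hq : 0 < q) (hpq : p + q = 1) {f g h : ℝ → ENNReal}
    (hf : Measurable f) (hg : Measurable g) (hh : Measurable h)
    (hf1 : ⨆ x, f x ≠ ⊤) (hg1 : ⨆ x, g x ≠ ⊤) (hf0 : ⨆ x, f x ≠ 0) (hg0 : ⨆ x, g x ≠ 0)
    (H : ∀ x y, f x ^ p * g y ^ q ≤ h (p * x + q * y)) :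
    (∫⁻ x, f x) ^ p * (∫⁻ x, g x) ^ q ≤ ∫⁻ x, h x := by
  set a := ⨆ x, f x
  set b := ⨆ x, g x
  have hc0 : a ^ p * b ^ q ≠ 0 := by
    simp [ENNReal.rpow_eq_zero_iff, hf0, hg0, hf1, hg1]
  have hct : a ^ p * b ^ q ≠ ⊤ :=
    ENNReal.mul_ne_top (ENNReal.rpow_ne_top_of_nonneg hp.le hf1) (ENNReal.rpow_ne_top_of_nonneg hq.le hg1)
  have hinv : (a ^ p * b ^ q)⁻¹ = a⁻¹ ^ p * b⁻¹ ^ q := by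
    rw [ENNReal.mul_inv, ENNReal.inv_rpow, ENNReal.inv_rpow] <;>
    simp [ENNReal.rpow_eq_zero_iff, ENNReal.rpow_eq_top_iff, hf0, hg0, hf1, hg1]
  have key := pl_norm hp hq hpq (f := fun x => a⁻¹ * f x) (g := fun x => b⁻¹ * g x)
    (h := fun x => (a ^ p * b ^ q)⁻¹ * h x) (hf.const_mul _) (hg.const_mul _) (hh.const_mul _)
    (by rw [← ENNReal.mul_iSup]; exact ENNReal.inv_mul_cancel hf0 hf1)
    (by rw [← ENNReal.mul_iSup]; exact ENNReal.inv_mul_cancel hg0 hg1)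
    (by
      intro x y
      rw [ENNReal.mul_rpow_of_nonneg _ _ hp.le, ENNReal.mul_rpow_of_nonneg _ _ hq.le, hinv,
        mul_mul_mul_comm]
      gcongr
      exact H x y)
  rw [lintegral_const_mul _ hf, lintegral_const_mul _ hg, lintegral_const_mul _ hh,
    ENNReal.mul_rpow_of_nonneg _ _ hp.le, ENNReal.mul_rpow_of_nonneg _ _ hq.le,
    mul_mul_mul_comm, ← hinv] at key
  exact (ENNReal.mul_le_mul_iff_right (ENNReal.inv_ne_zero.2 hct) (ENNReal.inv_ne_top.2 hc0)).1 key

theorem tendsto_trunc {f : ℝ → ENNReal} (hf : Measurable f) :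
    Filter.Tendsto (fun N : ℕ => ∫⁻ x, min (f x) N) Filter.atTop (nhds (∫⁻ x, f x)) := by
  have h1 : ∀ x, f x = ⨆ N : ℕ, min (f x) N := by
    intro x
    rw [← inf_iSup_eq]
    simp [ENNReal.iSup_natCast]
  have hm : Monotone fun (N : ℕ) (x : ℝ) => min (f x) (N : ENNReal) := by
    intro M N h x
    dsimp
    gcongr
  have := lintegral_iSup (μ := volume) (f := fun (N : ℕ) (x : ℝ) => min (f x) (N : ENNReal))
    (fun N => hf.min measurable_const) hm
  simp only [← h1] at this
  rw [this]
  apply tendsto_atTop_iSup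
  intro M N h
  exact lintegral_mono (hm h)

theorem pl_one {p q : ℝ} (hp : 0 < p) (hq : 0 < q) (hpq : p + q = 1) {f g h : ℝ → ENNReal}
    (hf : Measurable f) (hg : Measurable g) (hh : Measurable h)
    (H : ∀ x y, f x ^ p * g y ^ q ≤ h (p * x + q * y)) :
    (∫⁻ x, f x) ^ p * (∫⁻ x, g x) ^ q ≤ ∫⁻ x, h x := by
  by_cases hf0 : ∫⁻ x, f x = 0
  · simp [hf0, hp]
  by_cases hg0 : ∫⁻ x, g x = 0
  · simp [hg0, hq]
  have aux : ∀ {f : ℝ → ENNReal}, ∫⁻ x, f x ≠ 0 → ∀ N : ℕ, 1 ≤ N →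
      ⨆ x, min (f x) (N : ENNReal) ≠ ⊤ ∧ ⨆ x, min (f x) (N : ENNReal) ≠ 0 := by
    intro f hf N hN
    constructor
    · exact ne_top_of_le_ne_top (ENNReal.natCast_ne_top N) (iSup_le fun x => min_le_right _ _)
    · intro h0
      apply hf
      rw [ENNReal.iSup_eq_zero] at h0
      have : ∀ x, f x = 0 := by
        intro x
        have h2 := h0 x
        rcases min_choice (f x) (N : ENNReal) with h | h
        · rwa [h] at h2
        · rw [h] at h2
          simp at h2; omega
      simp [this]
  have T := ENNReal.Tendsto.mul
    ((ENNReal.continuous_rpow_const (y := p)).continuousAt.tendsto.comp (tendsto_trunc hf))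
    (Or.inl (by simp [hf0, ENNReal.rpow_eq_zero_iff, hp, not_lt.2 hp.le]))
    ((ENNReal.continuous_rpow_const (y := q)).continuousAt.tendsto.comp (tendsto_trunc hg))
    (Or.inl (by simp [hg0, ENNReal.rpow_eq_zero_iff, hq, not_lt.2 hq.le]))
  refine le_of_tendsto T ?_
  filter_upwards [Filter.eventually_ge_atTop 1] with N hN
  refine pl_bdd hp hq hpq (hf.min measurable_const) (hg.min measurable_const) hh
    (aux hf0 N hN).1 (aux hg0 N hN).1 (aux hf0 N hN).2 (aux hg0 N hN).2 fun x y => ?_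
  refine le_trans ?_ (H x y)
  gcongr <;> exact min_le_left _ _

theorem pl_pi {p q : ℝ} (hp : 0 < p) (hq : 0 < q) (hpq : p + q = 1) (n : ℕ) :
    ∀ {f g h : (Fin n → ℝ) → ENNReal}, Measurable f → Measurable g → Measurable h →
    (∀ x y, f x ^ p * g y ^ q ≤ h (p • x + q • y)) →
    (∫⁻ x, f x) ^ p * (∫⁻ x, g x) ^ q ≤ ∫⁻ x, h x := by
  induction n with
  | zero =>
    intro f g h hf hg hh H
    have : ∀ k : (Fin 0 → ℝ) → ENNReal, ∫⁻ x, k x = k 0 := by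
      intro k
      rw [volume_pi, Measure.pi_of_empty _ 0, lintegral_dirac]
    rw [this, this, this]
    convert H 0 0 using 2
  | succ n ih =>
    intro f g h hf hg hh H
    have mc : Measurable fun z : ℝ × (Fin n → ℝ) => (Fin.cons z.1 z.2 : Fin (n+1) → ℝ) := by
      refine measurable_pi_iff.2 fun i => ?_
      refine Fin.cases ?_ (fun i => ?_) i <;> simp <;> fun_prop
    have me := volume_preserving_piFinSuccAbove (fun _ : Fin (n+1) => ℝ) 0
    have red : ∀ {k : (Fin (n+1) → ℝ) → ENNReal}, Measurable k →
        ∫⁻ x, k x = ∫⁻ s : ℝ, ∫⁻ y : Fin n → ℝ, k (Fin.cons s y) := by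
      intro k hk
      have h1 := me.symm.lintegral_comp hk
      have h2 : ∀ a, (MeasurableEquiv.piFinSuccAbove (fun _ : Fin (n+1) => ℝ) 0).symm a
          = Fin.cons a.1 a.2 := by
        intro a
        simp [MeasurableEquiv.piFinSuccAbove, Fin.insertNthEquiv]
      simp only [h2] at h1
      rw [← h1]
      rw [Measure.volume_eq_prod, lintegral_prod (fun a : ℝ × (Fin n → ℝ) => k (Fin.cons a.1 a.2))
        (hk.comp mc).aemeasurable]
    rw [red hf, red hg, red hh]
    refine pl_one hp hq hpq (hf.comp mc).lintegral_prod_right' (hg.comp mc).lintegral_prod_right'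
      (hh.comp mc).lintegral_prod_right' fun s t => ?_
    refine ih (hf.comp (mc.comp measurable_prodMk_left)) (hg.comp (mc.comp measurable_prodMk_left))
      (hh.comp (mc.comp measurable_prodMk_left)) fun x y => ?_
    refine (H _ _).trans (le_of_eq ?_)
    congr 1
    ext i
    refine Fin.cases ?_ (fun i => ?_) i <;> simp

theorem pl_euc {p q : ℝ} (hp : 0 < p) (hq : 0 < q) (hpq : p + q = 1) {n : ℕ}
    {f g h : EuclideanSpace ℝ (Fin n) → ENNReal} (hf : Measurable f) (hg : Measurable g)
    (hh : Measurable h)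
    (H : ∀ x y, f x ^ p * g y ^ q ≤ h (p • x + q • y)) :
    (∫⁻ x, f x) ^ p * (∫⁻ x, g x) ^ q ≤ ∫⁻ x, h x := by
  have me := PiLp.volume_preserving_toLp (Fin n)
  rw [← me.lintegral_comp hf, ← me.lintegral_comp hg, ← me.lintegral_comp hh]
  exact pl_pi hp hq hpq n (hf.comp me.measurable) (hg.comp me.measurable) (hh.comp me.measurable)
    fun x y => H _ _

theorem gauge_le_iff' {n : ℕ} {E : Set (EuclideanSpace ℝ (Fin n))} (hE₁ : IsCompact E)
    (hE₂ : Convex ℝ E) (hE₃ : (0 : EuclideanSpace ℝ (Fin n)) ∈ interior E) {t : ℝ} (ht : 0 ≤ t)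
    (x : EuclideanSpace ℝ (Fin n)) : gauge E x ≤ t ↔ x ∈ t • E := by
  have hn : E ∈ nhds 0 := mem_interior_iff_mem_nhds.1 hE₃
  rcases ht.eq_or_lt with rfl | ht
  · rw [Set.zero_smul_set ⟨0, interior_subset hE₃⟩, Set.mem_zero,
      ← gauge_eq_zero (absorbent_nhds_zero hn) (NormedSpace.isVonNBounded_of_isBounded ℝ hE₁.isBounded)]
    exact ⟨fun h => le_antisymm h (gauge_nonneg _), fun h => h.le⟩
  · rw [Set.mem_smul_set_iff_inv_smul_mem₀ ht.ne', ← hE₁.isClosed.closure_eq,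
      ← gauge_le_one_iff_mem_closure hE₂ hn, gauge_smul_of_nonneg (inv_nonneg.2 ht.le),
      smul_eq_mul, inv_mul_le_iff₀ ht, mul_one, hE₁.isClosed.closure_eq]

theorem distE_eq {n : ℕ} {K E : Set (EuclideanSpace ℝ (Fin n))}
    (hK₁ : IsCompact K) (hK₃ : K.Nonempty)
    (hE₁ : IsCompact E) (hE₂ : Convex ℝ E) (hE₃ : (0 : EuclideanSpace ℝ (Fin n)) ∈ interior E)
    (x : EuclideanSpace ℝ (Fin n)) :
    distE E K x = sInf ((fun k => gauge E (x - k)) '' K) := by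
  have hn : E ∈ nhds 0 := mem_interior_iff_mem_nhds.1 hE₃
  have hc := continuous_gauge hE₂ hn
  have hset : ∀ t : ℝ, (0 ≤ t ∧ x ∈ K + t • E) ↔ ∃ k ∈ K, gauge E (x - k) ≤ t := by
    intro t
    constructor
    · rintro ⟨ht, k, hk, y, hy, rfl⟩
      refine ⟨k, hk, ?_⟩
      rw [gauge_le_iff' hE₁ hE₂ hE₃ ht]
      simpa using hy
    · rintro ⟨k, hk, h⟩
      have ht := (gauge_nonneg _).trans h
      rw [gauge_le_iff' hE₁ hE₂ hE₃ ht] at h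
      exact ⟨ht, k, hk, x - k, h, by simp⟩
  unfold distE
  simp only [hset]
  obtain ⟨k, hk, hmin⟩ := hK₁.exists_isMinOn hK₃
    (f := fun k => gauge E (x - k)) (by fun_prop)
  have h1 : IsLeast {t : ℝ | ∃ k ∈ K, gauge E (x - k) ≤ t} (gauge E (x - k)) :=
    ⟨⟨k, hk, le_rfl⟩, fun t ⟨k', hk', h⟩ => (hmin hk').trans h⟩
  have h2 : IsLeast ((fun k => gauge E (x - k)) '' K) (gauge E (x - k)) :=
    ⟨⟨k, hk, rfl⟩, by rintro _ ⟨k', hk', rfl⟩; exact hmin hk'⟩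
  rw [h1.csInf_eq, h2.csInf_eq]

theorem distE_cont {n : ℕ} {K E : Set (EuclideanSpace ℝ (Fin n))}
    (hK₁ : IsCompact K) (hK₃ : K.Nonempty)
    (hE₁ : IsCompact E) (hE₂ : Convex ℝ E) (hE₃ : (0 : EuclideanSpace ℝ (Fin n)) ∈ interior E) :
    Continuous (distE E K) := by
  have hc := continuous_gauge hE₂ (mem_interior_iff_mem_nhds.1 hE₃)
  have : distE E K = fun x => sInf ((fun k => gauge E (x - k)) '' K) :=
    funext (distE_eq hK₁ hK₃ hE₁ hE₂ hE₃)
  rw [this]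
  apply hK₁.continuous_sInf
  exact hc.comp (by fun_prop : Continuous fun z :
    EuclideanSpace ℝ (Fin n) × EuclideanSpace ℝ (Fin n) => z.1 - z.2)

theorem distE_nonneg {n : ℕ} (K E : Set (EuclideanSpace ℝ (Fin n)))
    (x : EuclideanSpace ℝ (Fin n)) : 0 ≤ distE E K x :=
  Real.sInf_nonneg fun _ h => h.1

theorem distE_le {n : ℕ} {K E : Set (EuclideanSpace ℝ (Fin n))}
    (hK₁ : IsCompact K) (hK₃ : K.Nonempty)
    (hE₁ : IsCompact E) (hE₂ : Convex ℝ E) (hE₃ : (0 : EuclideanSpace ℝ (Fin n)) ∈ interior E)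
    (x k : EuclideanSpace ℝ (Fin n)) (hk : k ∈ K) : distE E K x ≤ gauge E (x - k) := by
  rw [distE_eq hK₁ hK₃ hE₁ hE₂ hE₃]
  refine csInf_le ⟨0, ?_⟩ ⟨k, hk, rfl⟩
  rintro _ ⟨_, _, rfl⟩
  exact gauge_nonneg _

theorem le_distE {n : ℕ} {K E : Set (EuclideanSpace ℝ (Fin n))}
    (hK₁ : IsCompact K) (hK₃ : K.Nonempty)
    (hE₁ : IsCompact E) (hE₂ : Convex ℝ E) (hE₃ : (0 : EuclideanSpace ℝ (Fin n)) ∈ interior E) :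
    ∃ c d : ℝ, 0 < c ∧ ∀ x, c * (1 + ‖x‖) - d ≤ distE E K x := by
  obtain ⟨R, hR, hER⟩ := hE₁.isBounded.subset_closedBall_lt 0 0
  obtain ⟨r, hr, hKr⟩ := hK₁.isBounded.subset_closedBall_lt 0 0
  refine ⟨R⁻¹, R⁻¹ * (1 + r), inv_pos.2 hR, fun x => ?_⟩
  rw [distE_eq hK₁ hK₃ hE₁ hE₂ hE₃]
  refine le_csInf (hK₃.image _) ?_
  rintro _ ⟨k, hk, rfl⟩
  refine le_trans ?_ (le_gauge_of_subset_closedBall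
    (absorbent_nhds_zero (mem_interior_iff_mem_nhds.1 hE₃)) hR.le hER)
  have h1 : ‖k‖ ≤ r := by simpa using hKr hk
  have h2 : ‖x‖ ≤ ‖x - k‖ + ‖k‖ := by simpa using norm_add_le (x - k) k
  rw [div_eq_inv_mul, ← mul_sub]
  exact mul_le_mul_of_nonneg_left (by linarith) (inv_pos.2 hR).le

theorem integrable_exp_lin {n : ℕ} {c : ℝ} (hc : 0 < c) :
    Integrable fun x : EuclideanSpace ℝ (Fin n) => Real.exp (-(c * (1 + ‖x‖))) := by
  have h := integrable_one_add_norm (E := EuclideanSpace ℝ (Fin n)) (μ := volume)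
    (r := ((n + 1 : ℕ) : ℝ)) (by simp)
  refine (h.const_mul ((n + 1).factorial / c ^ (n + 1))).mono'
    (by fun_prop) (Filter.Eventually.of_forall fun x => ?_)
  have hx : 0 < 1 + ‖x‖ := by positivity
  have hp := Real.pow_div_factorial_le_exp (c * (1 + ‖x‖)) (by positivity) (n + 1)
  rw [Real.norm_of_nonneg (Real.exp_nonneg _), Real.exp_neg, Real.rpow_neg hx.le,
    Real.rpow_natCast]
  have : ((n + 1).factorial : ℝ) / c ^ (n + 1) * ((1 + ‖x‖) ^ (n + 1))⁻¹
      = ((c * (1 + ‖x‖)) ^ (n + 1) / (n + 1).factorial)⁻¹ := by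
    rw [mul_pow]; field_simp
  rw [this]
  exact inv_anti₀ (by positivity) hp

theorem u_growth {u : ℝ → ℝ} (hu₁ : ConvexOn ℝ (Set.Ici 0) u) (hu₂ : MonotoneOn u (Set.Ici 0))
    {t : ℝ} (ht : 0 ≤ t) (hut : u t ≠ u 0) :
    ∃ a b : ℝ, 0 < a ∧ ∀ s, 0 ≤ s → a * s - b ≤ u s := by
  have htp : 0 < t := ht.lt_of_ne (by rintro rfl; exact hut rfl)
  have hlt : u 0 < u t := lt_of_le_of_ne (hu₂ Set.self_mem_Ici ht ht) hut.symm
  have ha : 0 < (u t - u 0) / t := div_pos (by linarith) htp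
  refine ⟨(u t - u 0) / t, (u t - u 0) - u 0, ha, fun s hs => ?_⟩
  rcases le_or_gt s t with hst | hst
  · have h0 : u 0 ≤ u s := hu₂ Set.self_mem_Ici hs hs
    have : (u t - u 0) / t * s ≤ (u t - u 0) / t * t := mul_le_mul_of_nonneg_left hst ha.le
    rw [div_mul_cancel₀ _ htp.ne'] at this
    linarith
  · have h1 := hu₁.secant_mono (a := 0) (x := t) (y := s) Set.self_mem_Ici ht hs htp.ne'
      (htp.trans hst).ne' hst.le
    simp only [sub_zero] at h1
    have hs' := htp.trans hst
    have : (u t - u 0) / t * s ≤ (u s - u 0) / s * s := mul_le_mul_of_nonneg_right h1 hs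
    rw [div_mul_cancel₀ _ hs'.ne'] at this
    linarith

theorem cont_exp {n : ℕ} {u : ℝ → ℝ} (hu₃ : ContinuousOn u (Set.Ici 0)) (c : ℝ)
    {φ : EuclideanSpace ℝ (Fin n) → ℝ} (hφ : Continuous φ) (h0 : ∀ x, 0 ≤ φ x) :
    Continuous fun x => Real.exp (-u (φ x) / c) := by
  have : Continuous fun x => u (φ x) := hu₃.comp_continuous hφ h0
  exact Real.continuous_exp.comp (this.neg.div_const c)

theorem integrable_or {n : ℕ} {K E : Set (EuclideanSpace ℝ (Fin n))}
    (hK₁ : IsCompact K) (hK₃ : K.Nonempty)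
    (hE₁ : IsCompact E) (hE₂ : Convex ℝ E) (hE₃ : (0 : EuclideanSpace ℝ (Fin n)) ∈ interior E)
    {u : ℝ → ℝ} (hu₁ : ConvexOn ℝ (Set.Ici 0) u) (hu₂ : MonotoneOn u (Set.Ici 0))
    (hu₃ : ContinuousOn u (Set.Ici 0)) (r : ℝ) :
    Integrable (fun x => Real.exp (-u (distE E K x))) ∨
      (∫ x, Real.exp (-u (gauge E x) / r)) = 0 := by
  have hcont : Continuous fun x => Real.exp (-u (distE E K x)) := by
    simpa using cont_exp hu₃ 1 (distE_cont hK₁ hK₃ hE₁ hE₂ hE₃) (distE_nonneg K E)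
  by_cases hconst : ∀ t, 0 ≤ t → u t = u 0
  · simp only [hconst _ (gauge_nonneg _), hconst _ (distE_nonneg K E _)]
    rcases Nat.eq_zero_or_pos n with rfl | hn
    · left
      have : IsFiniteMeasure (volume : Measure (EuclideanSpace ℝ (Fin 0))) := by
        have : CompactSpace (EuclideanSpace ℝ (Fin 0)) := Finite.compactSpace
        infer_instance
      exact integrable_const _
    · right
      have : Nonempty (Fin n) := ⟨⟨0, hn⟩⟩
      simp [integral_const, Measure.real]
  · left
    push Not at hconst
    obtain ⟨t, ht, hut⟩ := hconst
    obtain ⟨a, b, ha, hab⟩ := u_growth hu₁ hu₂ ht hut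
    obtain ⟨c, d, hc, hcd⟩ := le_distE hK₁ hK₃ hE₁ hE₂ hE₃
    refine ((integrable_exp_lin (n := n) (mul_pos ha hc)).const_mul (Real.exp (a * d + b))).mono'
      hcont.aestronglyMeasurable (Filter.Eventually.of_forall fun x => ?_)
    rw [Real.norm_of_nonneg (Real.exp_nonneg _), ← Real.exp_add, Real.exp_le_exp]
    have h1 := hab _ (distE_nonneg K E x)
    have h2 := mul_le_mul_of_nonneg_left (hcd x) ha.le
    nlinarith

theorem first_part {n : ℕ} (K E : Set (EuclideanSpace ℝ (Fin n)))
    (hK₁ : IsCompact K) (hK₃ : K.Nonempty)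
    (hE₁ : IsCompact E) (hE₂ : Convex ℝ E) (hE₃ : (0 : EuclideanSpace ℝ (Fin n)) ∈ interior E)
    (u : ℝ → ℝ) (hu₁ : ConvexOn ℝ (Set.Ici 0) u) (hu₂ : MonotoneOn u (Set.Ici 0))
    (hu₃ : ContinuousOn u (Set.Ici 0))
    {l : ℝ} (hl : l ∈ Set.Ioo (0 : ℝ) 1) :
    willsGen u K E ≥
        (l ^ (-l) * (1 - l) ^ (-(1 - l))) ^ n *
          (∫ x, Real.exp (-u (gauge E x) / (1 - l))) ^ (1 - l) *
          (volume K).toReal ^ l := by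
  obtain ⟨hl0, hl1⟩ := hl
  have hq : 0 < 1 - l := by linarith
  unfold willsGen
  rcases integrable_or hK₁ hK₃ hE₁ hE₂ hE₃ hu₁ hu₂ hu₃ (1 - l) with hint | h0
  swap
  · rw [h0, Real.zero_rpow hq.ne', mul_zero, zero_mul]
    exact integral_nonneg fun x => Real.exp_nonneg _
  have hg := continuous_gauge hE₂ (mem_interior_iff_mem_nhds.1 hE₃)
  have hWc : Continuous fun x => Real.exp (-u (distE E K x)) := by
    simpa using cont_exp hu₃ 1 (distE_cont hK₁ hK₃ hE₁ hE₂ hE₃) (distE_nonneg K E)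
  have hGc : Continuous fun x : EuclideanSpace ℝ (Fin n) =>
      Real.exp (-u (gauge E ((1 - l) • x)) / (1 - l)) :=
    cont_exp hu₃ (1 - l) (φ := fun x => gauge E ((1 - l) • x)) (by fun_prop)
      (fun x => gauge_nonneg _)
  have hKm : MeasurableSet ((fun x => l • x) ⁻¹' K) :=
    hK₁.measurableSet.preimage (by fun_prop)
  have key := pl_euc hl0 hq (by ring) (n := n)
    (f := ((fun x => l • x) ⁻¹' K).indicator 1)
    (g := fun y => ENNReal.ofReal (Real.exp (-u (gauge E ((1 - l) • y)) / (1 - l))))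
    (h := fun x => ENNReal.ofReal (Real.exp (-u (distE E K x))))
    (measurable_one.indicator hKm) hGc.measurable.ennreal_ofReal hWc.measurable.ennreal_ofReal
    (by
      intro x y
      by_cases hx : l • x ∈ K
      · rw [Set.indicator_of_mem (Set.mem_preimage.2 hx), Pi.one_apply, ENNReal.one_rpow, one_mul,
          ENNReal.ofReal_rpow_of_nonneg (Real.exp_nonneg _) hq.le, ← Real.exp_mul,
          div_mul_cancel₀ _ hq.ne']
        apply ENNReal.ofReal_le_ofReal
        rw [Real.exp_le_exp, neg_le_neg_iff]
        apply hu₂ (distE_nonneg _ _ _) (gauge_nonneg _)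
        simpa using distE_le hK₁ hK₃ hE₁ hE₂ hE₃ (l • x + (1 - l) • y) (l • x) hx
      · rw [Set.indicator_of_notMem (fun h => hx (Set.mem_preimage.1 h)), ENNReal.zero_rpow_of_pos hl0, zero_mul]
        exact zero_le)
  have hfin : ∫⁻ x, ENNReal.ofReal (Real.exp (-u (distE E K x))) ≠ ⊤ := by
    have := hint.lintegral_lt_top
    exact this.ne
  have key2 := ENNReal.toReal_mono hfin key
  rw [← integral_eq_lintegral_of_nonneg_ae (Filter.Eventually.of_forall fun x => Real.exp_nonneg _)
    hWc.aestronglyMeasurable, ENNReal.toReal_mul, ← ENNReal.toReal_rpow, ← ENNReal.toReal_rpow,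
    ← integral_eq_lintegral_of_nonneg_ae (Filter.Eventually.of_forall fun x => Real.exp_nonneg _)
    hGc.aestronglyMeasurable, lintegral_indicator_one hKm,
    Measure.addHaar_preimage_smul _ hl0.ne',
    Measure.integral_comp_smul volume (fun x => Real.exp (-u (gauge E x) / (1 - l))) (1 - l),
    ENNReal.toReal_mul, ENNReal.toReal_ofReal (abs_nonneg _), abs_of_pos (by positivity),
    abs_of_pos (by positivity), smul_eq_mul, Real.mul_rpow (by positivity) ENNReal.toReal_nonneg,
    Real.mul_rpow (by positivity) (integral_nonneg fun x => Real.exp_nonneg _),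
    finrank_euclideanSpace_fin] at key2
  refine ge_iff_le.2 (le_trans (le_of_eq ?_) key2)
  have aux : ∀ r : ℝ, 0 < r → ((r ^ n)⁻¹) ^ r = (r ^ (-r)) ^ n := by
    intro r hr
    rw [← Real.rpow_natCast, ← Real.rpow_natCast, ← Real.rpow_neg hr.le, ← Real.rpow_mul hr.le,
      ← Real.rpow_mul hr.le]
    congr 1; ring
  rw [aux l hl0, aux (1 - l) hq, mul_pow]
  ring

/-- For convex bodies `K, E` with `0 ∈ int E`, `u ∈ co(ℝ≥0)` and
`λ ∈ (0,1)`: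
`W_u(K;E) ≥ (λ^{-λ}(1-λ)^{-(1-λ)})ⁿ (∫_{ℝⁿ} e^{-u(|x|_E)/(1-λ)} dx)^{1-λ} vol(K)^λ`;
in particular (for `E = B₂ⁿ`, `u(t) = πt²`),
`W(K) ≥ (λ^{-λ}(1-λ)^{-(1-λ)/2})ⁿ vol(K)^λ`. -/
theorem willsGen_lower_bound_volume {n : ℕ} (K E : Set (EuclideanSpace ℝ (Fin n)))
    (hK₁ : IsCompact K) (hK₂ : Convex ℝ K) (hK₃ : K.Nonempty)
    (hE₁ : IsCompact E) (hE₂ : Convex ℝ E) (hE₃ : (0 : EuclideanSpace ℝ (Fin n)) ∈ interior E)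
    (u : ℝ → ℝ) (hu₁ : ConvexOn ℝ (Set.Ici 0) u) (hu₂ : MonotoneOn u (Set.Ici 0))
    (hu₃ : ContinuousOn u (Set.Ici 0))
    {l : ℝ} (hl : l ∈ Set.Ioo (0 : ℝ) 1) :
    willsGen u K E ≥
        (l ^ (-l) * (1 - l) ^ (-(1 - l))) ^ n *
          (∫ x, Real.exp (-u (gauge E x) / (1 - l))) ^ (1 - l) *
          (volume K).toReal ^ l ∧
      wills K ≥ (l ^ (-l) * (1 - l) ^ (-(1 - l) / 2)) ^ n * (volume K).toReal ^ l := by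
  refine ⟨first_part K E hK₁ hK₃ hE₁ hE₂ hE₃ u hu₁ hu₂ hu₃ hl, ?_⟩
  have hB₁ : IsCompact (closedBall (0 : EuclideanSpace ℝ (Fin n)) 1) := isCompact_closedBall _ _
  have hB₂ : Convex ℝ (closedBall (0 : EuclideanSpace ℝ (Fin n)) 1) := convex_closedBall _ _
  have hB₃ : (0 : EuclideanSpace ℝ (Fin n)) ∈ interior (closedBall 0 1) :=
    mem_interior_iff_mem_nhds.2 (closedBall_mem_nhds _ one_pos)
  have h := first_part K (closedBall 0 1) hK₁ hK₃ hB₁ hB₂ hB₃ (fun t => π * t ^ 2)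
    (by simpa using (convexOn_pow 2).smul Real.pi_pos.le)
    (fun s hs t ht hst => by
      have : 0 ≤ s := hs
      dsimp only
      gcongr)
    (by fun_prop) hl
  obtain ⟨hl0, hl1⟩ := hl
  have hq : 0 < 1 - l := by linarith
  have hw : willsGen (fun t => π * t ^ 2) K (closedBall 0 1) = wills K := by
    unfold willsGen wills
    congr 1
    ext x
    rw [distE_eq hK₁ hK₃ hB₁ hB₂ hB₃, Metric.infDist_eq_iInf, sInf_image', neg_mul]
    simp [gauge_closedBall, dist_eq_norm]
  rw [hw] at h
  have hG : ∫ x : EuclideanSpace ℝ (Fin n),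
      Real.exp (-(π * gauge (closedBall 0 1) x ^ 2) / (1 - l)) = (1 - l) ^ ((n : ℝ) / 2) := by
    have := GaussianFourier.integral_rexp_neg_mul_sq_norm (V := EuclideanSpace ℝ (Fin n))
      (div_pos Real.pi_pos hq)
    rw [finrank_euclideanSpace_fin, div_div_cancel₀ Real.pi_pos.ne'] at this
    rw [← this]
    congr 1
    ext x
    rw [gauge_closedBall zero_le_one]
    congr 1
    ring
  rw [hG] at h
  refine ge_iff_le.2 (le_trans (le_of_eq ?_) h)
  have e : ((1 - l) ^ (-(1 - l) / 2)) ^ n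
      = ((1 - l) ^ (-(1 - l))) ^ n * ((1 - l) ^ ((n : ℝ) / 2)) ^ (1 - l) := by
    rw [← Real.rpow_mul hq.le, ← Real.rpow_natCast, ← Real.rpow_natCast, ← Real.rpow_mul hq.le,
      ← Real.rpow_mul hq.le, ← Real.rpow_add hq]
    congr 1
    ring
  rw [mul_pow, mul_pow, e]
  ring
end
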